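/- arXiv:1803.10498 — 7 statements merged into one kernel-verified Lean document; each statement's English description precedes it below -/
import Mathlib

section
/- Let R be a commutative ring, G a group, V an R[G]-module, V₁ ⊆ V a G-stable R-submodule, z an element of the center of G, and c ∈ R. Suppose that z acts by multiplication by c on V₁, that z acts by multiplication by c on the quotient module V/V₁, and that every R-linear G-equivariant map V/V₁ → V is zero. Then z acts by multiplication by c on all of V. -/
/-- If `z` is central in `G`, acts by the scalar `c ∈ R` on a `G`-stable `R`-submodule `V₁`
and on the quotient `V/V₁`, and every `R`-linear `G`-equivariant map `V/V₁ → V` is zero,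
then `z` acts by `c` on all of `V`. -/
theorem central_acts_by_scalar_of_hom_quotient_eq_zero
    {R : Type*} [CommRing R] {G : Type*} [Group G]
    {V : Type*} [AddCommGroup V] [Module R V]
    [DistribMulAction G V] [SMulCommClass G R V]
    (V₁ : Submodule R V) (hstable : ∀ (g : G) (v : V), v ∈ V₁ → g • v ∈ V₁)
    (z : G) (hz : z ∈ Subgroup.center G) (c : R)
    (hsub : ∀ v ∈ V₁, z • v = c • v)
    (hquot : ∀ v : V, z • v - c • v ∈ V₁)
    (hhom : ∀ f : (V ⧸ V₁) →ₗ[R] V,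
      (∀ (g : G) (v : V), f (Submodule.Quotient.mk (g • v)) = g • f (Submodule.Quotient.mk v)) →
      f = 0) :
    ∀ v : V, z • v = c • v := by
  intro v
  let d : V →ₗ[R] V := DistribSMul.toLinearMap R V z - c • LinearMap.id
  have hd : ∀ w, d w = z • w - c • w := fun _ => rfl
  have hker : V₁ ≤ LinearMap.ker d := fun w hw => by
    rw [LinearMap.mem_ker, hd, hsub w hw, sub_self]
  have hzero : V₁.liftQ d hker = 0 := hhom _ fun g w => by
    simp only [Submodule.liftQ_apply, hd]
    rw [smul_sub, smul_smul, smul_smul, Subgroup.mem_center_iff.mp hz g, smul_comm g c w]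
  rw [← sub_eq_zero, ← hd, ← V₁.liftQ_apply d (h := hker), hzero, LinearMap.zero_apply]
end

section
/- Let R be a commutative ring, S a submonoid of the multiplicative monoid of R, and M an R-module that is locally of finite length. Then there exists a unique pair (M₀, M₁) of R-submodules of M such that: (a) M is the internal direct sum of M₀ and M₁; (b) for every s ∈ S, multiplication by s is a bijection of M₀ onto itself; and (c) M₁ = {m ∈ M : s·m = 0 for some s ∈ S}. -/
/-- The submodule of elements contained in a Noetherian submodule `N` with `s • N = N` for all
`s ∈ S`. -/
def ordinaryPart {R : Type*} [CommRing R] (S : Submonoid R)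
    (M : Type*) [AddCommGroup M] [Module R M] : Submodule R M where
  carrier := {m | ∃ N : Submodule R M, m ∈ N ∧ IsNoetherian R N ∧
    ∀ s ∈ S, N.map (LinearMap.lsmul R M s) = N}
  zero_mem' := ⟨⊥, zero_mem _, inferInstance, fun _ _ => Submodule.map_bot _⟩
  add_mem' := by
    rintro a b ⟨N, ha, hN, hSN⟩ ⟨N', hb, hN', hSN'⟩
    exact ⟨N ⊔ N', Submodule.add_mem_sup ha hb, inferInstance, fun s hs => by
      rw [Submodule.map_sup, hSN s hs, hSN' s hs]⟩
  smul_mem' := by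
    rintro r a ⟨N, ha, hN⟩
    exact ⟨N, N.smul_mem r ha, hN⟩

/-- The submodule of elements killed by some element of `S`. -/
def nullPart {R : Type*} [CommRing R] (S : Submonoid R)
    (M : Type*) [AddCommGroup M] [Module R M] : Submodule R M where
  carrier := {m | ∃ s ∈ S, s • m = 0}
  zero_mem' := ⟨1, S.one_mem, smul_zero _⟩
  add_mem' := by
    rintro a b ⟨s, hs, ha⟩ ⟨t, ht, hb⟩
    refine ⟨s * t, S.mul_mem hs ht, ?_⟩
    rw [smul_add, mul_comm, mul_smul, ha, mul_comm, mul_smul, hb]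
    simp
  smul_mem' := by
    rintro r a ⟨s, hs, ha⟩
    exact ⟨s, hs, by rw [smul_comm, ha, smul_zero]⟩

section

variable {R : Type*} [CommRing R] {S : Submonoid R} {M : Type*} [AddCommGroup M] [Module R M]

theorem eq_zero_of_mem_ordinaryPart_of_smul_eq_zero {s : R} (hs : s ∈ S) {m : M}
    (hm : m ∈ ordinaryPart S M) (h : s • m = 0) : m = 0 := by
  obtain ⟨N, hmN, hN, hSN⟩ := hm
  have hsurj : Function.Surjective (LinearMap.lsmul R N s) := by
    rintro ⟨x, hx⟩
    rw [← hSN s hs] at hx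
    obtain ⟨y, hy, rfl⟩ := hx
    exact ⟨⟨y, hy⟩, rfl⟩
  have hinj := IsNoetherian.injective_of_surjective_endomorphism _ hsurj
  have : (⟨m, hmN⟩ : N) = 0 := hinj (by ext; simpa using h)
  exact congrArg Subtype.val this

theorem bijOn_smul_ordinaryPart {s : R} (hs : s ∈ S) :
    Set.BijOn (fun m : M => s • m) (ordinaryPart S M : Set M) (ordinaryPart S M : Set M) := by
  refine ⟨fun m hm => (ordinaryPart S M).smul_mem s hm, fun a ha b hb hab => ?_, ?_⟩
  · refine sub_eq_zero.mp (eq_zero_of_mem_ordinaryPart_of_smul_eq_zero hs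
      ((ordinaryPart S M).sub_mem ha hb) ?_)
    rw [smul_sub, sub_eq_zero]
    exact hab
  · rintro m ⟨N, hmN, hN, hSN⟩
    have hm := hmN
    rw [← hSN s hs] at hm
    obtain ⟨y, hy, rfl⟩ := hm
    exact ⟨y, ⟨N, hy, hN, hSN⟩, rfl⟩

theorem exists_map_lsmul_stable (S : Submonoid R) (N : Submodule R M) [IsArtinian R N] :
    ∃ t ∈ S, ∀ s ∈ S, (N.map (LinearMap.lsmul R M t)).map (LinearMap.lsmul R M s) =
      N.map (LinearMap.lsmul R M t) := by
  obtain ⟨_, ⟨t, ht, rfl⟩, hmin⟩ := IsArtinian.set_has_minimal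
    ((fun t : R => LinearMap.range (LinearMap.lsmul R N t)) '' (S : Set R))
    ⟨_, 1, S.one_mem, rfl⟩
  refine ⟨t, ht, fun s hs => le_antisymm ?_ ?_⟩
  · rintro _ ⟨x, hx, rfl⟩
    exact Submodule.smul_mem _ s hx
  · have hle : LinearMap.range (LinearMap.lsmul R N (s * t)) ≤
        LinearMap.range (LinearMap.lsmul R N t) := by
      rintro _ ⟨x, rfl⟩
      exact ⟨s • x, by simp [smul_smul, mul_comm]⟩
    have heq := eq_of_le_of_not_lt hle (hmin _ ⟨s * t, S.mul_mem hs ht, rfl⟩)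
    rintro _ ⟨x, hx, rfl⟩
    have hmem : t • (⟨x, hx⟩ : N) ∈ LinearMap.range (LinearMap.lsmul R N (s * t)) :=
      heq ▸ ⟨⟨x, hx⟩, rfl⟩
    obtain ⟨y, hy⟩ := hmem
    exact ⟨t • (y : M), ⟨y, y.2, rfl⟩, by
      simpa [smul_smul, mul_comm] using congrArg Subtype.val hy⟩

theorem isCompl_ordinaryPart_nullPart
    (hM : ∀ m : M, ∃ N : Submodule R M, m ∈ N ∧ IsFiniteLength R N) :
    IsCompl (ordinaryPart S M) (nullPart S M) := by
  refine ⟨Submodule.disjoint_def.mpr ?_, codisjoint_iff_le_sup.mpr fun m _ => ?_⟩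
  · rintro m hm ⟨s, hs, h⟩
    exact eq_zero_of_mem_ordinaryPart_of_smul_eq_zero hs hm h
  · obtain ⟨N, hm, hN⟩ := hM m
    obtain ⟨_, _⟩ := isFiniteLength_iff_isNoetherian_isArtinian.mp hN
    obtain ⟨t, ht, hst⟩ := exists_map_lsmul_stable S N
    have htm : t • m ∈ N.map (LinearMap.lsmul R M t) := ⟨m, hm, rfl⟩
    rw [← hst t ht] at htm
    obtain ⟨n, hn, hnm⟩ := htm
    refine Submodule.mem_sup.mpr
      ⟨n, ⟨_, hn, inferInstance, hst⟩, m - n, ⟨t, ht, ?_⟩, add_sub_cancel _ _⟩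
    rw [smul_sub, sub_eq_zero]
    exact hnm.symm

theorem le_ordinaryPart_of_injOn
    (hM : ∀ m : M, ∃ N : Submodule R M, m ∈ N ∧ IsFiniteLength R N) {P : Submodule R M}
    (hP : ∀ s ∈ S, Set.InjOn (fun m : M => s • m) (P : Set M)) : P ≤ ordinaryPart S M := by
  intro p hp
  obtain ⟨N, hpN, hN⟩ := hM p
  have hNP : IsFiniteLength R (N ⊓ P : Submodule R M) :=
    hN.of_injective (Submodule.inclusion_injective inf_le_left)
  obtain ⟨hnoeth, _⟩ := isFiniteLength_iff_isNoetherian_isArtinian.mp hNP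
  refine ⟨N ⊓ P, ⟨hpN, hp⟩, hnoeth, fun s hs => le_antisymm ?_ fun x hx => ?_⟩
  · rintro _ ⟨x, hx, rfl⟩
    exact Submodule.smul_mem _ s hx
  · have hinj : Function.Injective (LinearMap.lsmul R (N ⊓ P : Submodule R M) s) :=
      fun a b hab => Subtype.ext (hP s hs a.2.2 b.2.2 (congrArg Subtype.val hab))
    obtain ⟨y, hy⟩ := IsArtinian.surjective_of_injective_endomorphism _ hinj ⟨x, hx⟩
    exact ⟨y, y.2, congrArg Subtype.val hy⟩

end

/-- Ordinary/non-ordinary decomposition: if `M` is a locally finite length module over a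
commutative ring `R` and `S` is a submonoid of `R`, there is a unique pair of submodules
`(M₀, M₁)` with `M = M₀ ⊕ M₁`, every `s ∈ S` acting bijectively on `M₀`, and `M₁` equal to
the set of elements killed by some element of `S`. -/
theorem ordinary_decomposition_of_locallyFiniteLength
    {R : Type*} [CommRing R] (S : Submonoid R)
    {M : Type*} [AddCommGroup M] [Module R M]
    (hM : ∀ m : M, ∃ N : Submodule R M, m ∈ N ∧ IsFiniteLength R N) :
    ∃! p : Submodule R M × Submodule R M,
      IsCompl p.1 p.2 ∧
      (∀ s ∈ S, Set.BijOn (fun m : M => s • m) (p.1 : Set M) (p.1 : Set M)) ∧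
      (p.2 : Set M) = {m : M | ∃ s ∈ S, s • m = 0} := by
  refine ⟨(ordinaryPart S M, nullPart S M), ⟨isCompl_ordinaryPart_nullPart hM,
    fun s hs => bijOn_smul_ordinaryPart hs, rfl⟩, ?_⟩
  rintro ⟨P₀, P₁⟩ ⟨hcompl, hbij, hnull⟩
  obtain rfl : P₁ = nullPart S M := SetLike.coe_injective hnull
  have hle : P₀ ≤ ordinaryPart S M :=
    le_ordinaryPart_of_injOn hM fun s hs => (hbij s hs).injOn
  have hc := isCompl_ordinaryPart_nullPart (S := S) hM
  have heq : P₀ = ordinaryPart S M := eq_of_le_of_inf_le_of_sup_le hle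
    (hc.inf_eq_bot.trans_le bot_le) (le_top.trans_eq hcompl.sup_eq_top.symm)
  rw [heq]
end

section
/- Let R be a commutative ring, G a group, and ρ̄₁, …, ρ̄_k R[G]-modules such that for all i ≠ j every R-linear G-equivariant map ρ̄_i → ρ̄_j is zero. Let T be an R[G]-module equipped with two increasing chains 0 = T₀ ⊆ T₁ ⊆ ⋯ ⊆ T_k = T and 0 = T′₀ ⊆ T′₁ ⊆ ⋯ ⊆ T′_k = T of G-stable R-submodules such that, for each i ∈ {1, …, k}, both quotients T_i/T_{i−1} and T′_i/T′_{i−1} admit finite filtrations by G-stable submodules all of whose successive quotients are isomorphic, as R[G]-modules, to finite direct sums of copies of ρ̄_i. Then T_i = T′_i for all i. -/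
/-- An `A`-module `M` admits a finite filtration by submodules whose successive quotients are
isomorphic, as `A`-modules, to finite direct sums of copies of `σ`. -/
def HasFiltrationWithGradedPiecesCopiesOf (A : Type*) [Ring A]
    (σ : Type*) [AddCommGroup σ] [Module A σ]
    (M : Type*) [AddCommGroup M] [Module A M] : Prop :=
  ∃ (r : ℕ) (F : ℕ → Submodule A M),
    F 0 = ⊥ ∧ F r = ⊤ ∧ (∀ s < r, F s ≤ F (s + 1)) ∧
    ∀ s < r, ∃ n : ℕ,
      Nonempty ((↥(F (s + 1)) ⧸ (F s).comap (F (s + 1)).subtype) ≃ₗ[A] (Fin n → σ))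

section HomVanishing

variable {A : Type*} [Ring A] {M M' M'' N σ : Type*}
  [AddCommGroup M] [Module A M] [AddCommGroup M'] [Module A M'] [AddCommGroup M''] [Module A M'']
  [AddCommGroup N] [Module A N] [AddCommGroup σ] [Module A σ]

theorem subsingleton_linearMap_of_exact_left {i : M' →ₗ[A] M} {p : M →ₗ[A] M''}
    (hip : Function.Exact i p) (hp : Function.Surjective p)
    [Subsingleton (M' →ₗ[A] N)] [Subsingleton (M'' →ₗ[A] N)] :
    Subsingleton (M →ₗ[A] N) := by
  refine subsingleton_of_forall_eq 0 fun f ↦ ?_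
  have hker : LinearMap.ker p ≤ LinearMap.ker f := by
    rw [hip.linearMap_ker_eq, LinearMap.range_le_ker_iff]
    exact Subsingleton.elim _ _
  have hlift := Subsingleton.elim
    ((Submodule.liftQ _ f hker) ∘ₗ (p.quotKerEquivOfSurjective hp).symm.toLinearMap) 0
  ext x
  have hx : (p.quotKerEquivOfSurjective hp).symm (p x) = Submodule.Quotient.mk x :=
    (LinearEquiv.symm_apply_eq _).2 rfl
  simpa [hx] using LinearMap.congr_fun hlift (p x)

theorem subsingleton_linearMap_of_exact_right {i : M' →ₗ[A] M} {p : M →ₗ[A] M''}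
    (hip : Function.Exact i p) (hi : Function.Injective i)
    [Subsingleton (N →ₗ[A] M')] [Subsingleton (N →ₗ[A] M'')] :
    Subsingleton (N →ₗ[A] M) := by
  refine subsingleton_of_forall_eq 0 fun f ↦ ?_
  have hmem (x : N) : f x ∈ LinearMap.range i :=
    (hip _).1 (LinearMap.congr_fun (Subsingleton.elim (p ∘ₗ f) 0) x)
  have hlift := Subsingleton.elim
    ((LinearEquiv.ofInjective i hi).symm.toLinearMap ∘ₗ f.codRestrict _ hmem) 0
  ext x
  have hx : f.codRestrict _ hmem x = 0 := by simpa using LinearMap.congr_fun hlift x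
  exact congrArg Subtype.val hx

/-- Vanishing of `Hom(-, N)` propagates up a chain of submodules. -/
theorem subsingleton_linearMap_of_chain_left {r : ℕ} {F : ℕ → Submodule A M}
    (h0 : F 0 = ⊥) (hmono : ∀ s < r, F s ≤ F (s + 1))
    (hgr : ∀ s < r,
      Subsingleton ((↥(F (s + 1)) ⧸ (F s).comap (F (s + 1)).subtype) →ₗ[A] N)) :
    ∀ s ≤ r, Subsingleton (F s →ₗ[A] N) := by
  intro s hs
  induction s with
  | zero => rw [h0]; infer_instance
  | succ s ih =>
    have := ih (by lia)
    have := hgr s hs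
    refine subsingleton_linearMap_of_exact_left (i := Submodule.inclusion (hmono s hs))
      (p := Submodule.mkQ ((F s).comap (F (s + 1)).subtype)) ?_ (Submodule.mkQ_surjective _)
    rw [LinearMap.exact_iff, Submodule.ker_mkQ, Submodule.range_inclusion]

/-- Vanishing of `Hom(N, -)` propagates down the quotients by a chain of submodules. -/
theorem subsingleton_linearMap_of_chain_right {r : ℕ} {F : ℕ → Submodule A M}
    (hr : F r = ⊤) (hmono : ∀ s < r, F s ≤ F (s + 1)) {s : ℕ} (hs : s ≤ r)
    (hgr : ∀ t, s ≤ t → t < r →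
      Subsingleton (N →ₗ[A] (↥(F (t + 1)) ⧸ (F t).comap (F (t + 1)).subtype))) :
    Subsingleton (N →ₗ[A] M ⧸ F s) := by
  induction hs using Nat.decreasingInduction with
  | self =>
    rw [hr]; infer_instance
  | of_succ s hs ih =>
    have := ih fun t ht ↦ hgr t (by lia)
    have := hgr s le_rfl hs
    refine subsingleton_linearMap_of_exact_right
      (i := Submodule.mapQ ((F s).comap (F (s + 1)).subtype) (F s) (F (s + 1)).subtype le_rfl)
      (p := Submodule.factor (hmono s hs)) ?_ ?_
    · rw [LinearMap.exact_iff, Submodule.factor, Submodule.ker_mapQ, Submodule.range_mapQ]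
      simp
    · rw [← LinearMap.ker_eq_bot, Submodule.ker_mapQ, Submodule.mkQ_map_self]

theorem HasFiltrationWithGradedPiecesCopiesOf.subsingleton_linearMap_left
    (h : HasFiltrationWithGradedPiecesCopiesOf A σ M) [Subsingleton (σ →ₗ[A] N)] :
    Subsingleton (M →ₗ[A] N) := by
  obtain ⟨r, F, h0, hr, hmono, hgr⟩ := h
  have hF : Subsingleton (F r →ₗ[A] N) := by
    refine subsingleton_linearMap_of_chain_left h0 hmono (fun s hs ↦ ?_) r le_rfl
    obtain ⟨n, ⟨e⟩⟩ := hgr s hs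
    refine subsingleton_of_forall_eq 0 fun f ↦ ?_
    have hf : f ∘ₗ e.symm.toLinearMap = 0 :=
      LinearMap.pi_ext' fun _ ↦ Subsingleton.elim _ _
    ext1
    ext x
    simpa using LinearMap.congr_fun hf (e (Submodule.Quotient.mk x))
  rw [hr] at hF
  refine subsingleton_of_forall_eq 0 fun f ↦ ?_
  ext x
  exact LinearMap.congr_fun
    (Subsingleton.elim (f ∘ₗ (⊤ : Submodule A M).subtype) 0) ⟨x, trivial⟩

theorem HasFiltrationWithGradedPiecesCopiesOf.subsingleton_linearMap_right
    (h : HasFiltrationWithGradedPiecesCopiesOf A σ M) [Subsingleton (N →ₗ[A] σ)] :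
    Subsingleton (N →ₗ[A] M) := by
  obtain ⟨r, F, h0, hr, hmono, hgr⟩ := h
  have hF : Subsingleton (N →ₗ[A] M ⧸ F 0) := by
    refine subsingleton_linearMap_of_chain_right hr hmono r.zero_le fun s _ hs ↦ ?_
    obtain ⟨n, ⟨e⟩⟩ := hgr s hs
    refine subsingleton_of_forall_eq 0 fun f ↦ ?_
    ext x
    apply e.injective
    ext j
    simpa using LinearMap.congr_fun
      (Subsingleton.elim (LinearMap.proj j ∘ₗ e.toLinearMap ∘ₗ f) 0) x
  refine subsingleton_of_forall_eq 0 fun f ↦ ?_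
  ext x
  have := LinearMap.congr_fun (Subsingleton.elim ((F 0).mkQ ∘ₗ f) 0) x
  simpa [h0] using this

/-- If there are no nonzero maps between the `ρ i` for distinct `i`, the terms of one filtration
with graded pieces built from the `ρ i` are contained in those of any other. -/
theorem le_of_hasFiltrationWithGradedPiecesCopiesOf
    {k : ℕ} (ρ : Fin k → Type*) [∀ i, AddCommGroup (ρ i)] [∀ i, Module A (ρ i)]
    (hρ : ∀ i j, i ≠ j → ∀ f : ρ i →ₗ[A] ρ j, f = 0) {F F' : ℕ → Submodule A M}
    (h0 : F 0 = ⊥) (hmono : ∀ i < k, F i ≤ F (i + 1))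
    (hk' : F' k = ⊤) (hmono' : ∀ i < k, F' i ≤ F' (i + 1))
    (hgr : ∀ i : Fin k, HasFiltrationWithGradedPiecesCopiesOf A (ρ i)
      (↥(F ((i : ℕ) + 1)) ⧸ (F (i : ℕ)).comap (F ((i : ℕ) + 1)).subtype))
    (hgr' : ∀ i : Fin k, HasFiltrationWithGradedPiecesCopiesOf A (ρ i)
      (↥(F' ((i : ℕ) + 1)) ⧸ (F' (i : ℕ)).comap (F' ((i : ℕ) + 1)).subtype))
    {i : ℕ} (hi : i ≤ k) : F i ≤ F' i := by
  have hHom : Subsingleton (F i →ₗ[A] M ⧸ F' i) := by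
    refine subsingleton_linearMap_of_chain_right hk' hmono' hi fun t hit htk ↦ ?_
    refine subsingleton_linearMap_of_chain_left h0 (fun s hs ↦ hmono s (by lia))
      (fun s hs ↦ ?_) i le_rfl
    have hsk : s < k := by lia
    have hst : s ≠ t := by lia
    have : Subsingleton (ρ ⟨s, hsk⟩ →ₗ[A] ρ ⟨t, htk⟩) :=
      subsingleton_of_forall_eq 0 (hρ _ _ (by simpa using hst))
    have := (hgr' ⟨t, htk⟩).subsingleton_linearMap_right (N := ρ ⟨s, hsk⟩)
    exact (hgr ⟨s, hsk⟩).subsingleton_linearMap_left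
  intro x hx
  have := LinearMap.congr_fun (Subsingleton.elim ((F' i).mkQ ∘ₗ (F i).subtype) 0) ⟨x, hx⟩
  simpa using this

end HomVanishing

/-- Uniqueness of `P`-ordinary filtrations: if `Hom(ρ i, ρ j) = 0` for `i ≠ j` (representations
of a group `G` being encoded as modules over the group algebra `R[G]`), and `T` carries two
increasing chains of submodules `0 = T₀ ⊆ ⋯ ⊆ T_k = T` and `0 = T′₀ ⊆ ⋯ ⊆ T′_k = T` whose
`i`-th graded pieces are both successive extensions of finite direct sums of copies of `ρ i`,
then the two chains coincide. -/
theorem unique_filtration_of_hom_eq_zero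
    {R : Type*} [CommRing R] {G : Type*} [Group G]
    {k : ℕ} (ρ : Fin k → Type*)
    [∀ i, AddCommGroup (ρ i)] [∀ i, Module (MonoidAlgebra R G) (ρ i)]
    (hρ : ∀ i j, i ≠ j → ∀ f : ρ i →ₗ[MonoidAlgebra R G] ρ j, f = 0)
    {T : Type*} [AddCommGroup T] [Module (MonoidAlgebra R G) T]
    (Tc Tc' : ℕ → Submodule (MonoidAlgebra R G) T)
    (h0 : Tc 0 = ⊥) (hk : Tc k = ⊤) (hmono : ∀ i < k, Tc i ≤ Tc (i + 1))
    (h0' : Tc' 0 = ⊥) (hk' : Tc' k = ⊤) (hmono' : ∀ i < k, Tc' i ≤ Tc' (i + 1))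
    (hgr : ∀ i : Fin k, HasFiltrationWithGradedPiecesCopiesOf (MonoidAlgebra R G) (ρ i)
      (↥(Tc ((i : ℕ) + 1)) ⧸ (Tc (i : ℕ)).comap (Tc ((i : ℕ) + 1)).subtype))
    (hgr' : ∀ i : Fin k, HasFiltrationWithGradedPiecesCopiesOf (MonoidAlgebra R G) (ρ i)
      (↥(Tc' ((i : ℕ) + 1)) ⧸ (Tc' (i : ℕ)).comap (Tc' ((i : ℕ) + 1)).subtype)) :
    ∀ i ≤ k, Tc i = Tc' i := by
  exact fun i hi ↦ le_antisymm
    (le_of_hasFiltrationWithGradedPiecesCopiesOf ρ hρ h0 hmono hk' hmono' hgr hgr' hi)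
    (le_of_hasFiltrationWithGradedPiecesCopiesOf ρ hρ h0' hmono' hk hmono hgr' hgr hi)
end

section
/- Fix a prime p, an integer n ≥ 1, an integer i ≥ 1, and a partition n = n₁ + ⋯ + n_k. Let Γ_i denote the group of matrices g ∈ GL_n(ℤ_p) all entries of g − 1 lying in p^iℤ_p. Then the multiplication map (n̄, l, u) ↦ n̄ · l · u is a bijection from N̄_i × L_i × N_i onto Γ_i, where N̄_i (resp. N_i) is the set of block lower-triangular unipotent (resp. block upper-triangular unipotent) elements of Γ_i and L_i is the set of block diagonal elements of Γ_i. -/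
open Matrix

section Unipotent

variable {m R α : Type*} [DecidableEq m] [CommRing R] [LinearOrder α]

/-- `g` is block upper-triangular unipotent for the blocks cut out by `β`. Applied to
`OrderDual.toDual ∘ β`, this says that `g` is block lower-triangular unipotent. -/
def IsBlockUnipotent (β : m → α) (g : Matrix m m R) : Prop :=
  ∀ a b, β b ≤ β a → g a b = (1 : Matrix m m R) a b

theorem IsBlockUnipotent.one (β : m → α) : IsBlockUnipotent β (1 : Matrix m m R) :=
  fun _ _ _ => rfl

theorem IsBlockUnipotent.blockTriangular {β : m → α} {g : Matrix m m R}
    (hg : IsBlockUnipotent β g) : BlockTriangular g β := fun a b hab => by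
  rw [hg a b hab.le, one_apply_ne]
  rintro rfl
  exact hab.false

variable [Fintype m]

/-- Left multiplication by a block unipotent matrix does not change the block lower part of a
block upper-triangular matrix. -/
theorem IsBlockUnipotent.mul_apply {β : m → α} {g h : Matrix m m R}
    (hg : IsBlockUnipotent β g) (hh : BlockTriangular h β) {a b : m} (hab : β b ≤ β a) :
    (g * h) a b = h a b := by
  have : (g * h) a b = ((1 : Matrix m m R) * h) a b := by
    simp only [Matrix.mul_apply]
    refine Finset.sum_congr rfl fun c _ => ?_
    rcases le_or_gt (β c) (β a) with hc | hc
    · rw [hg a c hc]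
    · rw [hh (hab.trans_lt hc), mul_zero, mul_zero]
  rw [this, one_mul]

/-- Right multiplication by a block unipotent matrix does not change the block lower part of a
block upper-triangular matrix. -/
theorem IsBlockUnipotent.apply_mul {β : m → α} {g h : Matrix m m R}
    (hg : IsBlockUnipotent β g) (hh : BlockTriangular h β) {a b : m} (hab : β b ≤ β a) :
    (h * g) a b = h a b := by
  have : (h * g) a b = (h * (1 : Matrix m m R)) a b := by
    simp only [Matrix.mul_apply]
    refine Finset.sum_congr rfl fun c _ => ?_
    rcases le_or_gt (β b) (β c) with hc | hc
    · rw [hg c b hc]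
    · rw [hh (hc.trans_le hab), zero_mul, zero_mul]
  rw [this, mul_one]

theorem IsBlockUnipotent.mul {β : m → α} {g h : Matrix m m R}
    (hg : IsBlockUnipotent β g) (hh : IsBlockUnipotent β h) : IsBlockUnipotent β (g * h) :=
  fun a b hab => by rw [hg.mul_apply hh.blockTriangular hab, hh a b hab]

theorem IsBlockUnipotent.inv {β : m → α} {g : Matrix m m R} (hu : IsUnit g)
    (hg : IsBlockUnipotent β g) : IsBlockUnipotent β g⁻¹ := fun a b hab => by
  let := hu.invertible
  rw [← hg.mul_apply (blockTriangular_inv_of_blockTriangular hg.blockTriangular) hab,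
    mul_nonsing_inv _ ((isUnit_iff_isUnit_det g).1 hu)]

/-- The factors of a product of a block lower-triangular unipotent, a block diagonal and a block
upper-triangular unipotent matrix are determined by the product. -/
theorem IsBlockUnipotent.mul_mul_injective {β : m → α} {y l x y' l' x' : Matrix m m R}
    (hy : IsBlockUnipotent (OrderDual.toDual ∘ β) y)
    (hy' : IsBlockUnipotent (OrderDual.toDual ∘ β) y') (hyu' : IsUnit y')
    (hx : IsBlockUnipotent β x) (hxu : IsUnit x)
    (hx' : IsBlockUnipotent β x')
    (hl : ∀ a b, β a ≠ β b → l a b = 0) (hlu : IsUnit l)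
    (hl' : ∀ a b, β a ≠ β b → l' a b = 0)
    (h : y * l * x = y' * l' * x') : y = y' ∧ l = l' ∧ x = x' := by
  have hyd := (isUnit_iff_isUnit_det y').1 hyu'
  have hxd := (isUnit_iff_isUnit_det x).1 hxu
  have hz := (hy'.inv hyu').mul hy
  have hw := hx'.mul (hx.inv hxu)
  set z := y'⁻¹ * y with hz_def
  set w := x' * x⁻¹ with hw_def
  have key : z * l = l' * w := by
    calc z * l = y'⁻¹ * (y * l * x) * x⁻¹ := by
          simp only [hz_def, Matrix.mul_assoc, mul_nonsing_inv _ hxd, Matrix.mul_one]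
      _ = l' * w := by
          rw [h]
          simp only [hw_def, ← Matrix.mul_assoc, nonsing_inv_mul _ hyd, Matrix.one_mul]
  have hlt : BlockTriangular l (OrderDual.toDual ∘ β) := fun a b hab =>
    hl a b (ne_of_lt (OrderDual.toDual_lt_toDual.1 hab))
  have hlt' : BlockTriangular l' β := fun a b hab => hl' a b (ne_of_gt hab)
  have hzl : ∀ a b, β a ≤ β b → (z * l) a b = l a b := fun a b hab => hz.mul_apply hlt hab
  have hlw : ∀ a b, β b ≤ β a → (l' * w) a b = l' a b := fun a b hab => hw.apply_mul hlt' hab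
  have hll : l = l' := by
    ext a b
    by_cases hab : β a = β b
    · rw [← hzl a b hab.le, key, hlw a b hab.ge]
    · rw [hl a b hab, hl' a b hab]
  have hzl' : z * l = l := by
    ext a b
    rcases le_total (β a) (β b) with hab | hab
    · exact hzl a b hab
    · rw [key, hlw a b hab, hll]
  have hz1 : z = 1 := hlu.mul_right_cancel (by rw [hzl', one_mul])
  have hw1 : w = 1 := hlu.mul_left_cancel (by rw [mul_one]; nth_rw 1 [hll]; rw [← key, hzl'])
  refine ⟨?_, hll, ?_⟩
  · have := congrArg (y' * ·) hz1
    simpa [hz_def, ← Matrix.mul_assoc, mul_nonsing_inv _ hyd] using this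
  · have := congrArg (· * x) hw1
    simpa [hw_def, Matrix.mul_assoc, nonsing_inv_mul _ hxd] using this.symm

end Unipotent

section Elimination

/-- If `s` annihilates itself, then `1 + s` and `1 - s` are inverse to each other. -/
theorem one_add_mul_one_sub_eq_one {A : Type*} [Ring A] {s : A} (hs : s * s = 0) :
    (1 + s) * (1 - s) = 1 := by
  rw [add_mul, mul_sub, mul_sub, hs]
  simp

theorem one_sub_mul_one_add_eq_one {A : Type*} [Ring A] {s : A} (hs : s * s = 0) :
    (1 - s) * (1 + s) = 1 := by
  rw [sub_mul, mul_add, mul_add, hs]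
  simp

/-- One step of block Gaussian elimination: `e` is the idempotent of the pivot block, `f` that of
the blocks after it, `d` that of the blocks before it, and `K` is the inverse of the pivot block
`e * h * e`. -/
theorem exists_block_elimination {A : Type*} [Ring A] {d e f h K : A}
    (hff : f * f = f) (hef : e * f = 0) (hfe : f * e = 0) (hdf : d * f = 0) (hfd : f * d = 0)
    (heK : e * K = K) (hKe : K * e = K) (hKh : K * h * e = e) (hhK : e * h * K = e)
    (hehd : e * h * d = 0) (hdhe : d * h * e = 0) :
    ∃ h', h = (1 + f * h * K) * h' * (1 + K * h * f) ∧
      h' = (1 - f * h * K) * h * (1 - K * h * f) ∧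
      e * h' * f = 0 ∧ f * h' * e = 0 ∧ d * h' = d * h ∧ h' * d = h * d := by
  have hfK : f * K = 0 := by rw [← heK, ← mul_assoc, hfe, zero_mul]
  have hKf : K * f = 0 := by rw [← hKe, mul_assoc, hef, mul_zero]
  have hKhd : K * h * d = 0 := by
    rw [← hKe, mul_assoc K, mul_assoc K, hehd, mul_zero]
  have hdhK : d * h * K = 0 := by rw [← heK, ← mul_assoc, hdhe, zero_mul]
  have h₁ : (1 + f * h * K) * (1 - f * h * K) = 1 := one_add_mul_one_sub_eq_one (by
    rw [show f * h * K * (f * h * K) = f * h * (K * f) * (h * K) by noncomm_ring, hKf]; simp)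
  have h₂ : (1 - K * h * f) * (1 + K * h * f) = 1 := one_sub_mul_one_add_eq_one (by
    rw [show K * h * f * (K * h * f) = K * h * (f * K) * (h * f) by noncomm_ring, hfK]; simp)
  refine ⟨_, ?_, rfl, ?_, ?_, ?_, ?_⟩
  · rw [show (1 + f * h * K) * ((1 - f * h * K) * h * (1 - K * h * f)) * (1 + K * h * f) =
      (1 + f * h * K) * (1 - f * h * K) * h * ((1 - K * h * f) * (1 + K * h * f)) by
      simp only [mul_assoc], h₁, h₂, one_mul, mul_one]
  · rw [show e * ((1 - f * h * K) * h * (1 - K * h * f)) * f =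
      e * h * f - e * h * K * h * (f * f) - (e * f) * (h * K * h * (1 - K * h * f) * f) by
      noncomm_ring, hef, hhK, hff]
    simp
  · rw [show f * ((1 - f * h * K) * h * (1 - K * h * f)) * e =
      f * h * e - (f * f) * h * (K * h * e) - f * (1 - f * h * K) * h * K * h * (f * e) by
      noncomm_ring, hfe, hKh, hff]
    simp
  · rw [show d * ((1 - f * h * K) * h * (1 - K * h * f)) =
      d * h - d * h * K * h * f - (d * f) * (h * K * h * (1 - K * h * f)) by noncomm_ring,
      hdf, hdhK]
    simp
  · rw [show (1 - f * h * K) * h * (1 - K * h * f) * d =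
      h * d - f * h * (K * h * d) - (1 - f * h * K) * h * K * h * (f * d) by noncomm_ring,
      hfd, hKhd]
    simp

end Elimination

section Congruence

variable {m R S : Type*} [Fintype m] [DecidableEq m] [CommRing R] [CommRing S]

theorem isUnit_of_mapMatrix_eq_one (φ : R →+* S) [IsLocalHom φ] {g : Matrix m m R}
    (hg : φ.mapMatrix g = 1) : IsUnit g := by
  rw [isUnit_iff_isUnit_det]
  refine isUnit_of_map_unit φ _ ?_
  rw [RingHom.map_det, hg, det_one]
  exact isUnit_one

/-- The diagonal idempotent matrix cutting out the indices satisfying `P`. -/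
def indicatorMatrix (R : Type*) [CommRing R] (P : m → Prop) [DecidablePred P] : Matrix m m R :=
  diagonal fun a => if P a then 1 else 0

theorem indicatorMatrix_mul_apply (P : m → Prop) [DecidablePred P] (g : Matrix m m R) (a b : m) :
    (indicatorMatrix R P * g) a b = if P a then g a b else 0 := by
  simp [indicatorMatrix]

theorem mul_indicatorMatrix_apply (P : m → Prop) [DecidablePred P] (g : Matrix m m R) (a b : m) :
    (g * indicatorMatrix R P) a b = if P b then g a b else 0 := by
  simp [indicatorMatrix]

theorem indicatorMatrix_mul_self (P : m → Prop) [DecidablePred P] :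
    indicatorMatrix R P * indicatorMatrix R P = indicatorMatrix R P := by
  ext a b
  rw [indicatorMatrix_mul_apply]
  by_cases ha : P a <;> simp [indicatorMatrix, diagonal_apply, ha]

theorem indicatorMatrix_mul_eq_zero (P Q : m → Prop) [DecidablePred P] [DecidablePred Q]
    (h : ∀ a, P a → ¬ Q a) : indicatorMatrix R P * indicatorMatrix R Q = 0 := by
  ext a b
  rw [indicatorMatrix_mul_apply]
  by_cases ha : P a
  · rw [if_pos ha, Matrix.zero_apply, indicatorMatrix, diagonal_apply, if_neg (h a ha), ite_self]
  · simp [ha]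

/-- A matrix congruent to `1` is, up to block unipotent matrices congruent to `1` on both sides,
block diagonal in the rows and columns of the first `t` blocks. -/
theorem exists_eq_mul_mul_of_mapMatrix_eq_one (φ : R →+* S) [IsLocalHom φ] (β : m → ℕ)
    {g : Matrix m m R} (hg : φ.mapMatrix g = 1) (t : ℕ) :
    ∃ y h x : Matrix m m R, g = y * h * x ∧
      φ.mapMatrix y = 1 ∧ φ.mapMatrix h = 1 ∧ φ.mapMatrix x = 1 ∧
      IsBlockUnipotent (OrderDual.toDual ∘ β) y ∧ IsBlockUnipotent β x ∧
      ∀ a b, β a ≠ β b → β a < t ∨ β b < t → h a b = 0 := by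
  induction t with
  | zero =>
    exact ⟨1, g, 1, by simp, map_one _, hg, map_one _, .one _, .one _, by simp⟩
  | succ t ih =>
    obtain ⟨y, h, x, hgyx, hy, hh, hx, hyβ, hxβ, h0⟩ := ih
    set d : Matrix m m R := indicatorMatrix R fun a => β a < t
    set e : Matrix m m R := indicatorMatrix R fun a => β a = t
    set f : Matrix m m R := indicatorMatrix R fun a => t < β a
    have hee : e * e = e := indicatorMatrix_mul_self _
    have hef : e * f = 0 := indicatorMatrix_mul_eq_zero _ _ (by intros; omega)
    have hfe : f * e = 0 := indicatorMatrix_mul_eq_zero _ _ (by intros; omega)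
    have hdf : d * f = 0 := indicatorMatrix_mul_eq_zero _ _ (by intros; omega)
    have hfd : f * d = 0 := indicatorMatrix_mul_eq_zero _ _ (by intros; omega)
    have hehd : e * h * d = 0 := by
      ext a b
      rw [mul_indicatorMatrix_apply, indicatorMatrix_mul_apply]
      split_ifs with hb ha
      · exact h0 a b (by omega) (.inr hb)
      all_goals rfl
    have hdhe : d * h * e = 0 := by
      ext a b
      rw [mul_indicatorMatrix_apply, indicatorMatrix_mul_apply]
      split_ifs with hb ha
      · exact h0 a b (by omega) (.inl ha)
      all_goals rfl
    obtain ⟨u, hu⟩ : IsUnit (1 - e + e * h * e) := by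
      refine isUnit_of_mapMatrix_eq_one φ ?_
      rw [map_add, map_sub, map_mul, map_mul, hh, mul_one, ← map_mul, hee, map_one, sub_add_cancel]
    have hue : (u : Matrix m m R) * e = e * h * e := by
      rw [hu, add_mul, sub_mul, mul_assoc (e * h), hee, one_mul, sub_self, zero_add]
    have heu : e * (u : Matrix m m R) = e * h * e := by
      rw [hu, mul_add, mul_sub, ← mul_assoc, ← mul_assoc, hee, mul_one, sub_self, zero_add]
    set K : Matrix m m R := e * ((u⁻¹ : (Matrix m m R)ˣ) : Matrix m m R) * e with hK
    have heK : e * K = K := by rw [hK, ← mul_assoc, ← mul_assoc, hee]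
    have hKe : K * e = K := by rw [hK, mul_assoc, hee]
    have hKh : K * h * e = e := by
      rw [hK, mul_assoc, mul_assoc, ← mul_assoc e h e, ← hue, mul_assoc, Units.inv_mul_cancel_left,
        hee]
    have hhK : e * h * K = e := by
      rw [hK, ← mul_assoc, ← mul_assoc, ← heu, Units.mul_inv_cancel_right, hee]
    have hφK : φ.mapMatrix f * φ.mapMatrix K = 0 := by
      rw [← map_mul, ← heK, ← mul_assoc, hfe, zero_mul, map_zero]
    have hKφ : φ.mapMatrix K * φ.mapMatrix f = 0 := by
      rw [← map_mul, ← hKe, mul_assoc, hef, mul_zero, map_zero]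
    obtain ⟨h', hh', hdef, hehf, hfhe, hdh', hhd'⟩ :=
      exists_block_elimination (indicatorMatrix_mul_self _) hef hfe hdf hfd heK hKe hKh hhK hehd hdhe
    refine ⟨y * (1 + f * h * K), h', (1 + K * h * f) * x, ?_, ?_, ?_, ?_, hyβ.mul ?_,
      IsBlockUnipotent.mul ?_ hxβ, ?_⟩
    · rw [hgyx, show y * (1 + f * h * K) * h' * ((1 + K * h * f) * x) =
        y * ((1 + f * h * K) * h' * (1 + K * h * f)) * x by simp only [mul_assoc], ← hh']
    · simp [-RingHom.mapMatrix_apply, hy, hh, hφK]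
    · rw [hdef]
      simp [-RingHom.mapMatrix_apply, hh, hφK, hKφ]
    · simp [-RingHom.mapMatrix_apply, hx, hh, hKφ]
    · intro a b hab
      have hab : β a ≤ β b := hab
      rw [Matrix.add_apply, add_eq_left, ← hKe, ← mul_assoc,
        mul_indicatorMatrix_apply, mul_assoc, indicatorMatrix_mul_apply]
      split_ifs
      · omega
      all_goals rfl
    · intro a b hab
      rw [Matrix.add_apply, add_eq_left, ← heK, mul_indicatorMatrix_apply, mul_assoc, mul_assoc,
        indicatorMatrix_mul_apply]
      split_ifs
      · omega
      all_goals rfl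
    · intro a b hab ht
      rcases lt_trichotomy (β a) t with ha | ha | ha
      · have := congrFun₂ hdh' a b
        rw [indicatorMatrix_mul_apply, indicatorMatrix_mul_apply, if_pos ha, if_pos ha] at this
        rw [this, h0 a b hab (.inl ha)]
      all_goals
        rcases lt_trichotomy (β b) t with hb | hb | hb
        · have := congrFun₂ hhd' a b
          rw [mul_indicatorMatrix_apply, mul_indicatorMatrix_apply, if_pos hb, if_pos hb] at this
          rw [this, h0 a b hab (.inr hb)]
      · omega
      · have := congrFun₂ hehf a b
        rwa [mul_indicatorMatrix_apply, indicatorMatrix_mul_apply, if_pos hb, if_pos ha] at this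
      · have := congrFun₂ hfhe a b
        rwa [mul_indicatorMatrix_apply, indicatorMatrix_mul_apply, if_pos hb, if_pos ha] at this
      · omega

end Congruence


/-- Iwahori decomposition of the principal congruence subgroup `Γ_i` of `GL_n(ℤ_p)` (`i ≥ 1`)
with respect to the standard parabolic determined by the block map `β : Fin n → Fin k`
(monotone surjective, giving `k` consecutive blocks): multiplication is a bijection from
`N̄_i × L_i × N_i` onto `Γ_i`, where `N̄_i` (resp. `N_i`) is the set of block lower-triangular
(resp. upper-triangular) unipotent elements of `Γ_i` and `L_i` the set of block diagonal
elements of `Γ_i`. -/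
theorem iwahori_decomposition_congruence_subgroup
    (p : ℕ) [Fact p.Prime] {n k : ℕ} (hn : 1 ≤ n) {i : ℕ} (hi : 1 ≤ i)
    (β : Fin n → Fin k) (hβmono : Monotone β) (hβsurj : Function.Surjective β) :
    Set.BijOn
      (fun x : Matrix (Fin n) (Fin n) ℤ_[p] × Matrix (Fin n) (Fin n) ℤ_[p] ×
          Matrix (Fin n) (Fin n) ℤ_[p] => x.1 * x.2.1 * x.2.2)
      (({g : Matrix (Fin n) (Fin n) ℤ_[p] |
          (IsUnit g ∧ ∀ a b, (p : ℤ_[p]) ^ i ∣ (g - 1) a b) ∧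
          ∀ a b, β a ≤ β b → g a b = (1 : Matrix (Fin n) (Fin n) ℤ_[p]) a b}) ×ˢ
        (({g : Matrix (Fin n) (Fin n) ℤ_[p] |
            (IsUnit g ∧ ∀ a b, (p : ℤ_[p]) ^ i ∣ (g - 1) a b) ∧
            ∀ a b, β a ≠ β b → g a b = 0}) ×ˢ
          ({g : Matrix (Fin n) (Fin n) ℤ_[p] |
            (IsUnit g ∧ ∀ a b, (p : ℤ_[p]) ^ i ∣ (g - 1) a b) ∧
            ∀ a b, β b ≤ β a → g a b = (1 : Matrix (Fin n) (Fin n) ℤ_[p]) a b})))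
      {g : Matrix (Fin n) (Fin n) ℤ_[p] |
        IsUnit g ∧ ∀ a b, (p : ℤ_[p]) ^ i ∣ (g - 1) a b} := by
  have hI : Ideal.span {(p : ℤ_[p]) ^ i} ≠ ⊤ := by
    rw [Ne, Ideal.span_singleton_eq_top]
    exact fun h => PadicInt.prime_p.not_isUnit ((isUnit_pow_iff (by omega)).1 h)
  have : Nontrivial (ℤ_[p] ⧸ Ideal.span {(p : ℤ_[p]) ^ i}) := Ideal.Quotient.nontrivial_iff.2 hI
  set φ := Ideal.Quotient.mk (Ideal.span {(p : ℤ_[p]) ^ i})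
  have : IsLocalHom φ := .of_surjective φ Ideal.Quotient.mk_surjective
  have hΓ : ∀ g : Matrix (Fin n) (Fin n) ℤ_[p],
      (IsUnit g ∧ ∀ a b, (p : ℤ_[p]) ^ i ∣ (g - 1) a b) ↔ φ.mapMatrix g = 1 := by
    intro g
    have : (∀ a b, (p : ℤ_[p]) ^ i ∣ (g - 1) a b) ↔ φ.mapMatrix g = 1 := by
      rw [← sub_eq_zero, ← map_one φ.mapMatrix, ← map_sub, ← Matrix.ext_iff]
      simp only [RingHom.mapMatrix_apply, map_apply, Matrix.zero_apply, φ,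
        Ideal.Quotient.eq_zero_iff_mem, Ideal.mem_span_singleton]
    rw [this]
    exact ⟨And.right, fun h => ⟨isUnit_of_mapMatrix_eq_one φ h, h⟩⟩
  simp only [hΓ]
  refine ⟨?_, ?_, ?_⟩
  · rintro ⟨y, l, x⟩ ⟨⟨hy, -⟩, ⟨hl, -⟩, ⟨hx, -⟩⟩
    simp only [Set.mem_ofPred_eq, map_mul, hy, hl, hx, mul_one]
  · rintro ⟨y, l, x⟩ ⟨⟨hy, hyβ⟩, ⟨hl, hlβ⟩, ⟨hx, hxβ⟩⟩ ⟨y', l', x'⟩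
      ⟨⟨hy', hyβ'⟩, ⟨hl', hlβ'⟩, ⟨hx', hxβ'⟩⟩ h
    obtain ⟨rfl, rfl, rfl⟩ := IsBlockUnipotent.mul_mul_injective (β := β)
      hyβ hyβ' (isUnit_of_mapMatrix_eq_one φ hy')
      hxβ (isUnit_of_mapMatrix_eq_one φ hx) hxβ'
      hlβ (isUnit_of_mapMatrix_eq_one φ hl) hlβ' h
    rfl
  · intro g hg
    obtain ⟨y, l, x, hgyx, hy, hl, hx, hyβ, hxβ, hlβ⟩ :=
      exists_eq_mul_mul_of_mapMatrix_eq_one φ (fun a => (β a : ℕ)) hg k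
    exact ⟨(y, l, x), ⟨⟨hy, hyβ⟩, ⟨hl, fun a b hab =>
      hlβ a b (fun h => hab (Fin.ext h)) (.inl (β a).isLt)⟩, ⟨hx, hxβ⟩⟩, hgyx.symm⟩
end

section
/- Let p be a prime and E a complete nonarchimedean normed field equipped with an isometric ring homomorphism ℚ_p → E. For every integer a, the E-linear span of the functions ℤ_pˣ → E given by z ↦ z^j (the power computed in the group ℤ_pˣ and viewed in E via ℚ_p), where j ranges over the integers with j ≤ a, is dense in the space C(ℤ_pˣ, E) of continuous functions from ℤ_pˣ to E equipped with the supremum norm. -/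
section UnitPowers

variable {p : ℕ} [Fact p.Prime]

/-- Every continuous function on `ℤ_pˣ` extends to a continuous function on `ℤ_p`. -/
theorem PadicInt.exists_continuousMap_extending_units {E : Type*} [TopologicalSpace E] [Zero E]
    (f : C(ℤ_[p]ˣ, E)) : ∃ F : C(ℤ_[p], E), ∀ z : ℤ_[p]ˣ, F z = f z := by
  have hext (z : ℤ_[p]ˣ) : Function.extend Units.val f 0 (z : ℤ_[p]) = f z :=
    Units.val_injective.extend_apply f 0 z
  refine ⟨⟨Function.extend Units.val f 0, continuous_iff_continuousAt.2 fun x => ?_⟩, hext⟩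
  by_cases hx : x ∈ Set.range (Units.val : ℤ_[p]ˣ → ℤ_[p])
  · obtain ⟨z, rfl⟩ := hx
    rw [← Units.isOpenEmbedding_val.continuousAt_iff, funext hext (f := _ ∘ _)]
    exact f.continuous.continuousAt
  · have hclosed : IsClosed (Set.range (Units.val : ℤ_[p]ˣ → ℤ_[p])) :=
      (isCompact_range Units.continuous_val).isClosed
    refine (continuous_const (y := (0 : E))).continuousAt.congr ?_
    filter_upwards [hclosed.isOpen_compl.mem_nhds hx] with y hy
    exact (Function.extend_apply' (⇑f) (0 : ℤ_[p] → E) y hy).symm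

/-- The totient of `p ^ n` annihilates the units of `ℤ_p` modulo `p ^ n`. -/
theorem PadicInt.norm_units_pow_totient_mul_sub_one_le (n m : ℕ) (z : ℤ_[p]ˣ) :
    ‖((z ^ ((p ^ n).totient * m) : ℤ_[p]ˣ) : ℤ_[p]) - 1‖ ≤ (p : ℝ) ^ (-n : ℤ) := by
  rw [PadicInt.norm_le_pow_iff_mem_span_pow, ← PadicInt.ker_toZModPow, RingHom.mem_ker, map_sub,
    map_one, sub_eq_zero]
  have h := congrArg Units.val
    (ZMod.pow_totient (Units.map (PadicInt.toZModPow (p := p) n).toMonoidHom z))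
  simp only [Units.val_pow_eq_pow_val, Units.coe_map, RingHom.toMonoidHom_eq_coe, MonoidHom.coe_coe, Units.val_one] at h
  rw [Units.val_pow_eq_pow_val, map_pow, pow_mul, h, one_pow]

variable {E : Type*} [NormedField E]

/-- The continuous function `z ↦ z ^ j` on `ℤ_pˣ`, with values viewed in `E` through `ψ`. -/
noncomputable def PadicInt.unitsZPow (ψ : ℤ_[p] →+* E) (hψ : Continuous ψ) (j : ℤ) : C(ℤ_[p]ˣ, E) where
  toFun z := ψ ((z ^ j : ℤ_[p]ˣ) : ℤ_[p])
  continuous_toFun := hψ.comp (Units.continuous_val.comp (continuous_zpow j))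

/-- The span of the functions `z ↦ z ^ j` on `ℤ_pˣ`, for `j ≤ a`. -/
noncomputable def PadicInt.unitsZPowSpan (ψ : ℤ_[p] →+* E) (hψ : Continuous ψ) (a : ℤ) :
    Submodule E C(ℤ_[p]ˣ, E) :=
  Submodule.span E (PadicInt.unitsZPow ψ hψ '' Set.Iic a)

/-- Every integral power is a uniform limit of powers with exponents bounded by `a`. -/
theorem PadicInt.unitsZPow_mem_topologicalClosure {ψ : ℤ_[p] →+* E} (hψ : Isometry ψ) (a j : ℤ) :
    PadicInt.unitsZPow ψ hψ.continuous j ∈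
      (PadicInt.unitsZPowSpan ψ hψ.continuous a).topologicalClosure := by
  refine Metric.mem_closure_iff.2 fun ε hε => ?_
  obtain ⟨n, hn⟩ := PadicInt.exists_pow_neg_lt p hε
  set N := (p ^ n).totient * (j - a).toNat with hN
  have hpos : 0 < (p ^ n).totient :=
    Nat.totient_pos.2 (pow_pos (Fact.out : p.Prime).pos n)
  have hle : j - a ≤ N := (Int.self_le_toNat _).trans
    (by exact_mod_cast Nat.le_mul_of_pos_left (j - a).toNat hpos)
  refine ⟨_, Submodule.subset_span ⟨j - N, by simp only [Set.mem_Iic]; lia, rfl⟩,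
    (ContinuousMap.dist_lt_iff hε).2 fun z => lt_of_le_of_lt ?_ hn⟩
  change dist (ψ _) (ψ _) ≤ _
  have hz : z ^ j = z ^ (j - N) * z ^ N := by
    rw [← zpow_natCast, ← zpow_add, sub_add_cancel]
  rw [hψ.dist_eq, dist_eq_norm, hz, Units.val_mul, ← mul_sub_one, norm_mul, PadicInt.norm_units,
    one_mul]
  exact PadicInt.norm_units_pow_totient_mul_sub_one_le n _ z

variable [CompleteSpace E] [IsUltrametricDist E]

/-- The integral powers with exponents bounded by `a` span a dense subspace of `C(ℤ_pˣ, E)`. -/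
theorem PadicInt.topologicalClosure_unitsZPowSpan {ψ : ℤ_[p] →+* E} (hψ : Isometry ψ) (a : ℤ) :
    (PadicInt.unitsZPowSpan ψ hψ.continuous a).topologicalClosure = ⊤ := by
  refine Submodule.eq_top_iff'.2 fun f => ?_
  have hnorm (x : ℤ_[p]) : ‖ψ x‖ = ‖x‖ := hψ.norm_map_of_map_zero (map_zero ψ) x
  let : Module ℤ_[p] E := Module.compHom E ψ
  have hsmul (x : ℤ_[p]) (e : E) : x • e = ψ x * e := rfl
  have : IsBoundedSMul ℤ_[p] E :=
    .of_norm_smul_le fun x e => by rw [hsmul, norm_mul, hnorm]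
  obtain ⟨F, hF⟩ := PadicInt.exists_continuousMap_extending_units f
  let res : C(ℤ_[p]ˣ, ℤ_[p]) := ⟨Units.val, Units.continuous_val⟩
  have hf : F.comp res = f := ContinuousMap.ext hF
  rw [← hf]
  refine (Submodule.isClosed_topologicalClosure _).mem_of_tendsto
    ((ContinuousMap.continuous_precomp res).tendsto F |>.comp (PadicInt.hasSum_mahler F))
    (.of_forall fun s => ?_)
  have hsum (t : ℕ → C(ℤ_[p], E)) :
      (∑ n ∈ s, t n).comp res = ∑ n ∈ s, (t n).comp res := by
    ext z; simp
  simp only [Function.comp_apply, hsum]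
  refine Submodule.sum_mem _ fun n _ => ?_
  generalize (fwdDiff 1)^[n] F 0 = e
  have hfac : (n.factorial : E) ≠ 0 := by
    rw [← map_natCast ψ, ← norm_ne_zero_iff, hnorm, norm_ne_zero_iff]
    exact_mod_cast n.factorial_ne_zero
  set q := descPochhammer ℤ n
  have hq : (mahlerTerm e n).comp res = ((n.factorial : E)⁻¹ * e) •
      ∑ i ∈ q.support, (q.coeff i : E) • PadicInt.unitsZPow ψ hψ.continuous i := by
    ext z
    have h := congrArg ψ (Ring.descPochhammer_eq_factorial_smul_choose (z : ℤ_[p]) n)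
    simp only [Polynomial.smeval_eq_sum, Polynomial.sum_def, Polynomial.smul_pow, zsmul_eq_mul,
      nsmul_eq_mul, map_sum, map_mul, map_intCast, map_natCast] at h
    simp only [ContinuousMap.comp_apply, mahlerTerm_apply, mahler_apply, hsmul,
      ContinuousMap.smul_apply, ContinuousMap.sum_apply, smul_eq_mul, PadicInt.unitsZPow, res,
      ContinuousMap.coe_mk, zpow_natCast, Units.val_pow_eq_pow_val, q, h]
    field_simp
  rw [hq]
  exact Submodule.smul_mem _ _ (Submodule.sum_mem _ fun i _ => Submodule.smul_mem _ _
    (PadicInt.unitsZPow_mem_topologicalClosure hψ a i))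

end UnitPowers


/-- For any integer `a`, the `E`-linear span of the functions `z ↦ z^j` on `ℤ_pˣ`, for integers
`j ≤ a`, is dense (for the supremum norm) in the space of continuous functions `ℤ_pˣ → E`,
where `E` is a complete nonarchimedean normed field receiving an isometric embedding of
`ℚ_p`. -/
theorem span_bounded_powers_dense_continuous_units
    (p : ℕ) [Fact p.Prime] {E : Type*} [NormedField E] [CompleteSpace E]
    [IsUltrametricDist E] (φ : ℚ_[p] →+* E) (hφ : Isometry φ) (a : ℤ)
    (f : ℤ_[p]ˣ → E) (hf : Continuous f) {ε : ℝ} (hε : 0 < ε) :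
    ∃ g ∈ Submodule.span E {h : ℤ_[p]ˣ → E |
        ∃ j : ℤ, j ≤ a ∧ h = fun z => φ (((z ^ j : ℤ_[p]ˣ) : ℤ_[p]) : ℚ_[p])},
      ∀ z : ℤ_[p]ˣ, ‖f z - g z‖ < ε := by
  have hψ : Isometry (φ.comp PadicInt.Coe.ringHom) := hφ.comp isometry_subtype_coe
  have hmem := (PadicInt.topologicalClosure_unitsZPowSpan hψ a).symm ▸
    Submodule.mem_top (x := (⟨f, hf⟩ : C(ℤ_[p]ˣ, E)))
  obtain ⟨g, hg, hfg⟩ := Metric.mem_closure_iff.1 hmem ε hε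
  refine ⟨g, ?_, fun z => ?_⟩
  · have h := Submodule.mem_map_of_mem (f := ContinuousMap.coeFnLinearMap E) hg
    rw [PadicInt.unitsZPowSpan, Submodule.map_span] at h
    refine Submodule.span_mono ?_ h
    rintro _ ⟨_, ⟨j, hj, rfl⟩, rfl⟩
    exact ⟨j, hj, rfl⟩
  · rw [← dist_eq_norm]
    exact (ContinuousMap.dist_lt_iff hε).1 hfg z
end

section
/- Let p be a prime, r ≥ 1 an integer, and E a complete nonarchimedean normed field equipped with an isometric ring homomorphism ℚ_p → E. For every integer a, the E-linear span of the functions GL_r(ℤ_p) → E of the form g ↦ P(g · ι(det g)⁻¹) · (det g)^j, where P ranges over the polynomial functions in the r² matrix entries with coefficients in E, j ranges over the integers with j ≤ a, and (det g)^j is computed in ℤ_pˣ and viewed in E via ℚ_p, is dense in the space C(GL_r(ℤ_p), E) of continuous functions with the supremum norm. -/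
namespace PadicDensity

open Topology Filter

theorem pow_dvd_pow_sub_ite {p : ℕ} [hp : Fact p.Prime] (t : ℤ_[p]) (m : ℕ) :
    (p : ℤ_[p]) ^ m ∣ t ^ ((p - 1) * p ^ m) - if ‖t‖ < 1 then 0 else 1 := by
  split_ifs with h
  · rw [sub_zero]
    refine (pow_dvd_pow_of_dvd ((PadicInt.norm_lt_one_iff_dvd t).1 h) m).trans (pow_dvd_pow t ?_)
    calc m ≤ p ^ m := (Nat.lt_pow_self hp.out.one_lt).le
      _ ≤ (p - 1) * p ^ m := Nat.le_mul_of_pos_left _ (Nat.sub_pos_of_lt hp.out.one_lt)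
  · have hker : ∀ s : ℤ_[p], PadicInt.toZMod s = 0 ↔ (p : ℤ_[p]) ∣ s := fun s => by
      rw [← RingHom.mem_ker, PadicInt.ker_toZMod, PadicInt.maximalIdeal_eq_span_p,
        Ideal.mem_span_singleton]
    have hdvd : (p : ℤ_[p]) ∣ t ^ (p - 1) - 1 := by
      rw [← hker, map_sub, map_pow, map_one, sub_eq_zero]
      exact ZMod.pow_card_sub_one_eq_one
        fun h0 => h ((PadicInt.norm_lt_one_iff_dvd t).2 ((hker t).1 h0))
    have := dvd_sub_pow_of_dvd_sub hdvd m
    rw [one_pow, ← pow_mul] at this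
    exact (pow_dvd_pow _ m.le_succ).trans this

variable {X E : Type*} [TopologicalSpace X] [NormedField E]

/-- `U` is clopen and its indicator function belongs to `T`. -/
def HasIndicator (T : Subalgebra E C(X, E)) (U : Set X) : Prop :=
  ∃ e ∈ T, ⇑e = U.indicator 1

namespace HasIndicator

variable {T : Subalgebra E C(X, E)} {U V : Set X}

theorem univ (T : Subalgebra E C(X, E)) : HasIndicator T Set.univ :=
  ⟨1, T.one_mem, by ext; simp⟩

theorem compl (hU : HasIndicator T U) : HasIndicator T Uᶜ := by
  obtain ⟨e, he, h⟩ := hU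
  refine ⟨1 - e, T.sub_mem T.one_mem he, ?_⟩
  rw [Set.indicator_compl, ← h]
  rfl

theorem inter (hU : HasIndicator T U) (hV : HasIndicator T V) : HasIndicator T (U ∩ V) := by
  obtain ⟨e, he, h⟩ := hU
  obtain ⟨d, hd, h'⟩ := hV
  refine ⟨e * d, T.mul_mem he hd, ?_⟩
  rw [ContinuousMap.coe_mul, h, h', Set.inter_indicator_one]

theorem union (hU : HasIndicator T U) (hV : HasIndicator T V) : HasIndicator T (U ∪ V) := by
  simpa only [Set.compl_inter, compl_compl] using (hU.compl.inter hV.compl).compl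

theorem isOpen (hU : HasIndicator T U) : IsOpen U := by
  obtain ⟨e, -, h⟩ := hU
  convert isOpen_ne.preimage e.continuous (t := {0}ᶜ) using 1
  rw [h]
  ext x
  by_cases hx : x ∈ U <;> simp [hx]

end HasIndicator

variable [CompactSpace X] {T : Subalgebra E C(X, E)} {p : ℕ} [hp : Fact p.Prime]
  {φ : ℚ_[p] →+* E}

theorem hasIndicator_norm_lt_one [IsUltrametricDist E] (hφ : Isometry φ)
    (hT : IsClosed (T : Set C(X, E))) {w : C(X, E)} (hw : w ∈ T)
    (h_int : ∀ x, ∃ t : ℤ_[p], w x = φ t) : HasIndicator T {x | ‖w x‖ < 1} := by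
  have hnorm : ∀ q, ‖φ q‖ = ‖q‖ := fun q => by simpa using hφ.norm_map_of_map_zero (map_zero φ) q
  have hcl : IsClopen {x | ‖w x‖ < 1} := by
    simpa [Set.preimage, Metric.ball] using
      (IsUltrametricDist.isClopen_ball (0 : E) 1).preimage w.continuous
  let e : C(X, E) := ⟨_, hcl.continuous_indicator (f := (1 : X → E)) continuous_const⟩
  have htend : Tendsto (fun m : ℕ => w ^ ((p - 1) * p ^ m)) atTop (𝓝 (1 - e)) := by
    rw [tendsto_iff_norm_sub_tendsto_zero]
    have hp1 : (1 : ℝ) < p := by exact_mod_cast hp.out.one_lt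
    refine squeeze_zero (fun _ => norm_nonneg _) (g := fun m : ℕ => ((p : ℝ)⁻¹) ^ m) (fun m => ?_)
      (tendsto_pow_atTop_nhds_zero_of_lt_one (by positivity) (inv_lt_one_of_one_lt₀ hp1))
    rw [ContinuousMap.norm_le _ (by positivity)]
    intro x
    obtain ⟨t, ht⟩ := h_int x
    have hx : (w ^ ((p - 1) * p ^ m) - (1 - e)) x =
        φ ((t ^ ((p - 1) * p ^ m) - if ‖t‖ < 1 then 0 else 1 : ℤ_[p]) : ℚ_[p]) := by
      have he : e x = if ‖t‖ < 1 then 1 else 0 := by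
        simp only [e, ContinuousMap.coe_mk, Set.indicator_apply, Set.mem_ofPred_eq, ht, hnorm,
          PadicInt.norm_def, Pi.one_apply]
      simp only [ContinuousMap.sub_apply, ContinuousMap.pow_apply, ContinuousMap.one_apply, he, ht]
      split_ifs <;> simp
    rw [hx, hnorm, ← PadicInt.norm_def, inv_pow, ← zpow_natCast, ← zpow_neg,
      PadicInt.norm_le_pow_iff_mem_span_pow, Ideal.mem_span_singleton]
    exact pow_dvd_pow_sub_ite t m
  refine ⟨e, ?_, rfl⟩
  have := hT.mem_of_tendsto htend (.of_forall fun m => T.pow_mem hw _)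
  simpa using T.sub_mem T.one_mem this

theorem hasIndicator_norm_lt_pow [IsUltrametricDist E] (hφ : Isometry φ)
    (hT : IsClosed (T : Set C(X, E))) (n : ℕ) {w : C(X, E)} (hw : w ∈ T)
    (h_int : ∀ x, ∃ t : ℤ_[p], w x = φ t) : HasIndicator T {x | ‖w x‖ < (p : ℝ)⁻¹ ^ n} := by
  have hnorm : ∀ q, ‖φ q‖ = ‖q‖ := fun q => by simpa using hφ.norm_map_of_map_zero (map_zero φ) q
  have hp0 : (0 : ℝ) < p := by exact_mod_cast hp.out.pos
  have hp1 : (1 : ℝ) ≤ p := by exact_mod_cast hp.out.one_lt.le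
  have hpE : (p : E) ≠ 0 := by
    rw [← map_natCast φ, map_ne_zero]
    exact_mod_cast hp.out.ne_zero
  have hpn : ‖(p : E)‖ = (p : ℝ)⁻¹ := by
    rw [← map_natCast φ, hnorm, Padic.norm_p]
  induction n generalizing w with
  | zero => simpa using hasIndicator_norm_lt_one hφ hT hw h_int
  | succ n ih =>
    have h1 := hasIndicator_norm_lt_one hφ hT hw h_int
    obtain ⟨e, he, hind⟩ := id h1
    have hv : ∀ x, ((p : E)⁻¹ • (e * w)) x = if ‖w x‖ < 1 then (p : E)⁻¹ * w x else 0 := by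
      intro x
      simp only [ContinuousMap.smul_apply, ContinuousMap.mul_apply, hind, Set.indicator_apply,
        Set.mem_ofPred_eq, smul_eq_mul]
      split_ifs <;> simp
    have h2 := ih (T.smul_mem (T.mul_mem he hw) (p : E)⁻¹) fun x => by
      rw [hv]
      split_ifs with h
      · obtain ⟨t, ht⟩ := h_int x
        rw [ht, hnorm, ← PadicInt.norm_def, PadicInt.norm_lt_one_iff_dvd] at h
        obtain ⟨s, rfl⟩ := h
        refine ⟨s, ?_⟩
        rw [ht]
        push_cast
        rw [map_mul, map_natCast, inv_mul_cancel_left₀ hpE]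
      · exact ⟨0, by simp⟩
    convert h1.inter h2 using 1
    ext x
    simp only [Set.mem_ofPred_eq, Set.mem_inter_iff, hv]
    have hle : (p : ℝ)⁻¹ ^ (n + 1) ≤ 1 := pow_le_one₀ (by positivity) (inv_le_one_of_one_le₀ hp1)
    have hiff : ‖(p : E)⁻¹ * w x‖ < (p : ℝ)⁻¹ ^ n ↔ ‖w x‖ < (p : ℝ)⁻¹ ^ (n + 1) := by
      rw [norm_mul, norm_inv, hpn, pow_succ, inv_inv, ← lt_div_iff₀' hp0, div_eq_mul_inv]
    constructor
    · intro h
      rw [if_pos (h.trans_le hle), hiff]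
      exact ⟨h.trans_le hle, h⟩
    · rintro ⟨h, h'⟩
      rwa [if_pos h, hiff] at h'

theorem HasIndicator.exists_mem_subset {x : X} {W : Set X} (hW : IsOpen W) (hxW : x ∈ W)
    (hsep : ∀ y, y ≠ x → ∃ U, HasIndicator T U ∧ x ∈ U ∧ y ∉ U) :
    ∃ U, HasIndicator T U ∧ x ∈ U ∧ U ⊆ W := by
  have := hW.isClosed_compl.isCompact.induction_on
    (p := fun s => ∃ U, HasIndicator T U ∧ x ∈ U ∧ s ⊆ Uᶜ) ⟨_, .univ T, trivial, by simp⟩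
    (fun s t hst ⟨U, hU, hx, h⟩ => ⟨U, hU, hx, hst.trans h⟩)
    (fun s t ⟨U, hU, hx, h⟩ ⟨V, hV, hx', h'⟩ => ⟨U ∩ V, hU.inter hV, ⟨hx, hx'⟩, by
      rw [Set.compl_inter]
      exact Set.union_subset_union h h'⟩)
    (fun y hy => by
      obtain ⟨U, hU, hx, hyU⟩ := hsep y (by rintro rfl; exact hy hxW)
      exact ⟨Uᶜ, mem_nhdsWithin_of_mem_nhds (hU.compl.isOpen.mem_nhds hyU), U, hU, hx, le_rfl⟩)
  obtain ⟨U, hU, hx, h⟩ := this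
  exact ⟨U, hU, hx, Set.compl_subset_compl.1 h⟩

theorem eq_top_of_hasIndicator (hT : IsClosed (T : Set C(X, E)))
    (hsep : ∀ x y : X, y ≠ x → ∃ U, HasIndicator T U ∧ x ∈ U ∧ y ∉ U) : T = ⊤ := by
  refine Algebra.eq_top_iff.2 fun f => ?_
  rw [← SetLike.mem_coe, ← hT.closure_eq, Metric.mem_closure_iff]
  intro ε hε
  have := (isCompact_univ (X := X)).induction_on
    (p := fun s => ∃ U, HasIndicator T U ∧ s ⊆ U ∧ ∃ g ∈ T, ∀ x ∈ U, dist (f x) (g x) < ε)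
    ⟨∅, by simpa using (HasIndicator.univ T).compl, le_rfl, 0, T.zero_mem, by simp⟩
    (fun s t hst ⟨U, hU, h, hg⟩ => ⟨U, hU, hst.trans h, hg⟩)
    (fun s t ⟨U, hU, h, g, hg, hfg⟩ ⟨V, hV, h', k, hk, hfk⟩ => by
      refine ⟨U ∪ V, hU.union hV, Set.union_subset_union h h', ?_⟩
      obtain ⟨e, he, hind⟩ := hU
      refine ⟨e * g + (1 - e) * k,
        T.add_mem (T.mul_mem he hg) (T.mul_mem (T.sub_mem T.one_mem he) hk), fun x hx => ?_⟩
      by_cases hxU : x ∈ U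
      · simpa [hind, hxU] using hfg x hxU
      · simpa [hind, hxU] using hfk x (hx.resolve_left hxU))
    (fun x _ => by
      obtain ⟨U, hU, hxU, hsub⟩ := HasIndicator.exists_mem_subset
        (Metric.isOpen_ball.preimage f.continuous) (Metric.mem_ball_self hε : f x ∈ _) (hsep x)
      exact ⟨U, mem_nhdsWithin_of_mem_nhds (hU.isOpen.mem_nhds hxU), U, hU, le_rfl,
        algebraMap E _ (f x), T.algebraMap_mem _, fun y hy => by
          simpa [Algebra.algebraMap_eq_smul_one] using hsub hy⟩)
  obtain ⟨U, -, hU, g, hg, hfg⟩ := this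
  exact ⟨g, hg, (ContinuousMap.dist_lt_iff hε).2 fun x => hfg x (hU trivial)⟩

/-- A `p`-adic Stone–Weierstrass theorem: a closed subalgebra of `C(X, E)` whose `ℤ_[p]`-valued
members separate the points of `X` is everything. -/
theorem eq_top_of_separatesPoints [IsUltrametricDist E] (hφ : Isometry φ)
    (hT : IsClosed (T : Set C(X, E)))
    (hsep : ∀ x y : X, y ≠ x → ∃ w ∈ T, (∀ z, ∃ t : ℤ_[p], w z = φ t) ∧ w y ≠ w x) : T = ⊤ := by
  refine eq_top_of_hasIndicator hT fun x y hxy => ?_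
  obtain ⟨w, hw, h_int, hne⟩ := hsep x y hxy
  have hp1 : (1 : ℝ) < p := by exact_mod_cast hp.out.one_lt
  obtain ⟨n, hn⟩ := exists_pow_lt_of_lt_one (norm_pos_iff.2 (sub_ne_zero.2 hne))
    (inv_lt_one_of_one_lt₀ hp1)
  have hval : ∀ z, (w - algebraMap E C(X, E) (w x)) z = w z - w x := fun z => by
    simp [Algebra.algebraMap_eq_smul_one]
  refine ⟨_, hasIndicator_norm_lt_pow hφ hT n (T.sub_mem hw (T.algebraMap_mem (w x)))
    fun z => ?_, ?_, ?_⟩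
  · obtain ⟨s, hs⟩ := h_int x
    obtain ⟨t, ht⟩ := h_int z
    exact ⟨t - s, by rw [hval, ht, hs, PadicInt.coe_sub, map_sub]⟩
  · simp only [Set.mem_ofPred_eq, hval, sub_self, norm_zero]
    positivity
  · simpa only [Set.mem_ofPred_eq, hval, not_lt] using hn.le

/-- The closed subalgebra of multipliers of the closure of a subspace of `C(X, E)`. -/
def multipliers (V : Submodule E C(X, E)) : Subalgebra E C(X, E) where
  carrier := {u | ∀ v ∈ V.topologicalClosure, u * v ∈ V.topologicalClosure}
  mul_mem' {u u'} hu hu' v hv := by simpa only [mul_assoc] using hu _ (hu' v hv)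
  add_mem' {u u'} hu hu' v hv := by
    simpa only [add_mul] using Submodule.add_mem _ (hu v hv) (hu' v hv)
  algebraMap_mem' c v hv := by
    simpa only [← Algebra.smul_def] using Submodule.smul_mem _ c hv

theorem isClosed_multipliers (V : Submodule E C(X, E)) :
    IsClosed (multipliers V : Set C(X, E)) := by
  have : (multipliers V : Set C(X, E)) =
      ⋂ v ∈ V.topologicalClosure, (· * v) ⁻¹' (V.topologicalClosure : Set C(X, E)) := by
    ext u
    simp only [Set.mem_iInter]
    rfl
  rw [this]
  exact isClosed_biInter fun v _ =>
    V.isClosed_topologicalClosure.preimage (continuous_mul_const v)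

theorem mem_multipliers {V : Submodule E C(X, E)} {u : C(X, E)} (hu : ∀ v ∈ V, u * v ∈ V) :
    u ∈ multipliers V := fun _ hv =>
  map_mem_closure (continuous_const_mul u) hv hu

end PadicDensity


/-- For any integer `a`, the `E`-linear span of the functions
`g ↦ P(g·ι(det g)⁻¹)·(det g)^j` on `GL_r(ℤ_p)` — where `P` runs over polynomials in the `r²`
matrix entries with coefficients in `E`, `j` over the integers `≤ a`, and
`ι(v) = diag(v,1,…,1)` — is dense (for the supremum norm) in the continuous functions
`GL_r(ℤ_p) → E`, where `E` is a complete nonarchimedean normed field receiving an isometric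
embedding of `ℚ_p`. -/
theorem span_bounded_algebraic_dense_continuous_GL
    (p : ℕ) [Fact p.Prime] {r : ℕ} (hr : 1 ≤ r)
    {E : Type*} [NormedField E] [CompleteSpace E] [IsUltrametricDist E]
    (φ : ℚ_[p] →+* E) (hφ : Isometry φ) (a : ℤ)
    (f : Matrix.GeneralLinearGroup (Fin r) ℤ_[p] → E) (hf : Continuous f)
    {ε : ℝ} (hε : 0 < ε) :
    ∃ g ∈ Submodule.span E
        {h : Matrix.GeneralLinearGroup (Fin r) ℤ_[p] → E |
          ∃ (P : MvPolynomial (Fin r × Fin r) E) (j : ℤ), j ≤ a ∧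
            h = fun x : Matrix.GeneralLinearGroup (Fin r) ℤ_[p] =>
              MvPolynomial.eval
                (fun q : Fin r × Fin r =>
                  φ ((((x : Matrix (Fin r) (Fin r) ℤ_[p]) *
                      Matrix.diagonal (fun t : Fin r =>
                        if t = (⟨0, hr⟩ : Fin r) then
                          (((Matrix.GeneralLinearGroup.det x)⁻¹ : ℤ_[p]ˣ) : ℤ_[p])
                        else 1)) q.1 q.2 :
                    ℚ_[p])))
                P *
              φ (((Matrix.GeneralLinearGroup.det x ^ j : ℤ_[p]ˣ) : ℤ_[p]) : ℚ_[p])},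
      ∀ x, ‖f x - g x‖ < ε := by
  have : CompactSpace (Matrix (Fin r) (Fin r) ℤ_[p]) :=
    inferInstanceAs (CompactSpace (Fin r → Fin r → ℤ_[p]))
  have : CompactSpace (Matrix (Fin r) (Fin r) ℤ_[p])ᵐᵒᵖ :=
    MulOpposite.opHomeomorph.compactSpace
  have : CompactSpace (Matrix.GeneralLinearGroup (Fin r) ℤ_[p]) :=
    Units.isClosedEmbedding_embedProduct.compactSpace
  let D : Matrix.GeneralLinearGroup (Fin r) ℤ_[p] → Matrix (Fin r) (Fin r) ℤ_[p] := fun x =>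
    Matrix.diagonal fun t => if t = (⟨0, hr⟩ : Fin r) then
      (((Matrix.GeneralLinearGroup.det x)⁻¹ : ℤ_[p]ˣ) : ℤ_[p]) else 1
  have hcoe : Continuous fun t : ℤ_[p] => φ (t : ℚ_[p]) :=
    hφ.continuous.comp continuous_subtype_val
  have hdet : Continuous fun x : Matrix.GeneralLinearGroup (Fin r) ℤ_[p] =>
      Matrix.GeneralLinearGroup.det x := by fun_prop
  have hD : Continuous D := by
    refine Continuous.matrix_diagonal (continuous_pi fun t => ?_)
    split_ifs
    · fun_prop
    · exact continuous_const
  let entry (q : Fin r × Fin r) : C(Matrix.GeneralLinearGroup (Fin r) ℤ_[p], E) :=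
    ⟨fun x => φ (((x : Matrix (Fin r) (Fin r) ℤ_[p]) * D x) q.1 q.2 : ℤ_[p]),
      hcoe.comp ((Units.continuous_val.matrix_mul hD).matrix_elem q.1 q.2)⟩
  let detPow (j : ℤ) : C(Matrix.GeneralLinearGroup (Fin r) ℤ_[p], E) :=
    ⟨fun x => φ ((Matrix.GeneralLinearGroup.det x ^ j : ℤ_[p]ˣ) : ℤ_[p]),
      hcoe.comp (Units.continuous_val.comp (hdet.zpow j))⟩
  have hmul : ∀ i j, detPow i * detPow j = detPow (i + j) := fun i j => by
    ext x
    simp [detPow, zpow_add]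
  set S : Submodule E (Matrix.GeneralLinearGroup (Fin r) ℤ_[p] → E) := Submodule.span E _
  let V : Submodule E C(Matrix.GeneralLinearGroup (Fin r) ℤ_[p], E) :=
    S.comap (ContinuousMap.coeFnLinearMap E)
  have hentry : ∀ q, entry q ∈ PadicDensity.multipliers V := fun q =>
    PadicDensity.mem_multipliers fun v hv => by
      refine (Submodule.map_span_le (LinearMap.mulLeft E (⇑(entry q))) _ S).2 ?_
        (Submodule.mem_map_of_mem hv)
      rintro _ ⟨P, j, hj, rfl⟩
      refine Submodule.subset_span ⟨MvPolynomial.X q * P, j, hj, ?_⟩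
      ext x
      simp [entry, D, mul_assoc]
  have hdetInv : detPow (-1) ∈ PadicDensity.multipliers V :=
    PadicDensity.mem_multipliers fun v hv => by
      refine (Submodule.map_span_le (LinearMap.mulLeft E (⇑(detPow (-1)))) _ S).2 ?_
        (Submodule.mem_map_of_mem hv)
      rintro _ ⟨P, j, hj, rfl⟩
      refine Submodule.subset_span ⟨P, -1 + j, by omega, ?_⟩
      ext x
      have := DFunLike.congr_fun (hmul (-1) j) x
      simp only [ContinuousMap.mul_apply] at this
      simp only [LinearMap.mulLeft_apply, Pi.mul_apply]
      rw [mul_left_comm]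
      exact congrArg (_ * ·) this
  have htop : PadicDensity.multipliers V = ⊤ := by
    refine PadicDensity.eq_top_of_separatesPoints hφ (PadicDensity.isClosed_multipliers V)
      fun x y hxy => ?_
    by_contra! H
    have hinj : ∀ s t : ℤ_[p], φ s = φ t → s = t := fun s t h => Subtype.ext (φ.injective h)
    have h1 : Matrix.GeneralLinearGroup.det y = Matrix.GeneralLinearGroup.det x := by
      have := Units.ext (hinj _ _ (H _ hdetInv fun z => ⟨_, rfl⟩))
      rwa [zpow_neg_one, zpow_neg_one, inv_inj] at this
    have h2 : (y : Matrix (Fin r) (Fin r) ℤ_[p]) * D x = x * D x := by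
      ext i k
      have := hinj _ _ (H _ (hentry (i, k)) fun z => ⟨_, rfl⟩)
      have hDy : D y = D x := by simp only [D, h1]
      rw [hDy] at this
      rw [this]
    have hunit : IsUnit (D x) := by
      rw [Matrix.isUnit_iff_isUnit_det, Matrix.det_diagonal]
      refine IsUnit.prod_univ_iff.2 fun t => ?_
      split_ifs
      · exact Units.isUnit _
      · exact isUnit_one
    exact hxy (Units.ext (hunit.mul_left_injective h2))
  have ha : detPow a ∈ V := Submodule.subset_span ⟨1, a, le_rfl, by ext x; simp [detPow]⟩
  have hmem : (⟨f, hf⟩ * detPow (-a)) * detPow a ∈ V.topologicalClosure :=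
    (htop ▸ Algebra.mem_top : (⟨f, hf⟩ * detPow (-a)) ∈ PadicDensity.multipliers V) _
      (V.le_topologicalClosure ha)
  have hone : detPow 0 = 1 := by
    ext x
    simp [detPow]
  rw [mul_assoc, hmul, neg_add_cancel, hone, mul_one] at hmem
  obtain ⟨g, hg, hfg⟩ := Metric.mem_closure_iff.1 hmem ε hε
  refine ⟨g, hg, fun x => ?_⟩
  rw [← dist_eq_norm]
  exact (ContinuousMap.dist_lt_iff hε).1 hfg x
end

section
/- Let p be a prime, n ≥ 1 an integer, and E a complete nonarchimedean normed field equipped with an isometric ring homomorphism ℚ_p → E. The E-linear span of the monomial functions (ℤ_pˣ)^n → E given by (z₁, …, z_n) ↦ z₁^{λ₁} ⋯ z_n^{λ_n} (powers computed in ℤ_pˣ and viewed in E via ℚ_p), where (λ₁, …, λ_n) ranges over the tuples of integers with λ₁ > λ₂ > ⋯ > λ_n, is dense in the space C((ℤ_pˣ)^n, E) of continuous functions from (ℤ_pˣ)^n to E with the supremum norm. -/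
open Topology

namespace PadicInt

variable {p : ℕ} [Fact p.Prime]

theorem toZModPow_eq_toZModPow_iff (k : ℕ) (x y : ℤ_[p]) :
    toZModPow k x = toZModPow k y ↔ ‖x - y‖ ≤ (p : ℝ) ^ (-k : ℤ) := by
  rw [norm_le_pow_iff_mem_span_pow, ← ker_toZModPow, RingHom.mem_ker, map_sub, sub_eq_zero]

theorem isLocallyConstant_toZModPow (k : ℕ) :
    IsLocallyConstant (toZModPow k : ℤ_[p] → ZMod (p ^ k)) := by
  have hp : (0 : ℝ) < (p : ℝ) ^ (-k : ℤ) :=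
    zpow_pos (by exact_mod_cast (Fact.out : p.Prime).pos) _
  refine (IsLocallyConstant.iff_eventually_eq _).2 fun x => ?_
  filter_upwards [Metric.ball_mem_nhds x hp] with y hy
  rw [toZModPow_eq_toZModPow_iff, ← dist_eq_norm]
  exact (Metric.mem_ball.1 hy).le

/-- The indicator function of a residue class modulo `p ^ k`, as a continuous function. -/
noncomputable def residueIndicator (k : ℕ) (c : ZMod (p ^ k)) : C(ℤ_[p], ℚ_[p]) where
  toFun x := if toZModPow k x = c then 1 else 0
  continuous_toFun :=
    ((isLocallyConstant_toZModPow k).comp fun d => if d = c then (1 : ℚ_[p]) else 0).continuous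

/-- The inclusion of `ℤ_[p]` in `ℚ_[p]`, as a continuous function. -/
def inclusion (p : ℕ) [Fact p.Prime] : C(ℤ_[p], ℚ_[p]) where
  toFun x := x
  continuous_toFun := continuous_subtype_val

@[simp]
theorem inclusion_apply (x : ℤ_[p]) : inclusion p x = x := rfl

/-- A closed subring of `C(ℤ_[p], ℚ_[p])` containing the constants and the inclusion is
everything. -/
theorem mem_of_isClosed_of_const_mem_of_inclusion_mem (S : Subring C(ℤ_[p], ℚ_[p]))
    (hS : IsClosed (S : Set C(ℤ_[p], ℚ_[p])))
    (hconst : ∀ c : ℚ_[p], ContinuousMap.const ℤ_[p] c ∈ S)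
    (hincl : inclusion p ∈ S) (g : C(ℤ_[p], ℚ_[p])) : g ∈ S := by
  have hpoly (k : ℕ) : ∃ h ∈ S, ∀ x : ℤ_[p],
      h x = (((descPochhammer ℤ k).smeval x : ℤ_[p]) : ℚ_[p]) := by
    induction k with
    | zero => exact ⟨1, S.one_mem, fun x => by simp⟩
    | succ k ih =>
      obtain ⟨h, hh, hx⟩ := ih
      refine ⟨h * (inclusion p - ContinuousMap.const _ (k : ℚ_[p])),
        S.mul_mem hh (S.sub_mem hincl (hconst _)), fun x => ?_⟩
      rw [descPochhammer_succ_right, Polynomial.smeval_mul]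
      simp [hx, Polynomial.smeval_sub, Polynomial.smeval_natCast]
  have : IsBoundedSMul ℤ_[p] ℚ_[p] := .of_norm_smul_le fun x a => by
    rw [Algebra.smul_def, norm_mul, algebraMap_apply, padic_norm_e_of_padicInt]
  have hterm (a : ℚ_[p]) (k : ℕ) : mahlerTerm a k ∈ S := by
    obtain ⟨h, hh, hx⟩ := hpoly k
    have heq : mahlerTerm a k = h * ContinuousMap.const _ ((k.factorial : ℚ_[p])⁻¹ * a) := by
      ext x
      have hk : (k.factorial : ℚ_[p]) ≠ 0 := by exact_mod_cast k.factorial_ne_zero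
      rw [mahlerTerm_apply, mahler_apply, ContinuousMap.mul_apply, hx,
        Ring.descPochhammer_eq_factorial_smul_choose]
      simp [Algebra.smul_def]
      field_simp
    rw [heq]
    exact S.mul_mem hh (hconst _)
  exact hS.mem_of_tendsto (hasSum_mahler g)
    (Filter.Eventually.of_forall fun s => S.sum_mem fun k _ => hterm _ k)

end PadicInt

section Density

variable {p : ℕ} [Fact p.Prime] {ι E : Type*} [NormedField E]

/-- Pullback of a function `ℤ_p → ℚ_p` along a coordinate of `(ℤ_pˣ)^ι`, with values in `E`. -/
noncomputable def coordinatePullback (φ : ℚ_[p] →+* E) (hφ : Isometry φ) (t : ι) :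
    C(ℤ_[p], ℚ_[p]) →+* C(ι → ℤ_[p]ˣ, E) :=
  (φ.compLeftContinuous (ι → ℤ_[p]ˣ) hφ.continuous).comp
    (ContinuousMap.compRightAlgHom ℚ_[p] ℚ_[p]
      ⟨fun z : ι → ℤ_[p]ˣ => (z t : ℤ_[p]),
        Units.continuous_val.comp (continuous_apply t)⟩).toRingHom

@[simp]
theorem coordinatePullback_apply (φ : ℚ_[p] →+* E) (hφ : Isometry φ) (t : ι)
    (g : C(ℤ_[p], ℚ_[p])) (z : ι → ℤ_[p]ˣ) :
    coordinatePullback φ hφ t g z = φ (g (z t)) := rfl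

theorem continuous_coordinatePullback (φ : ℚ_[p] →+* E) (hφ : Isometry φ) (t : ι) :
    Continuous (coordinatePullback φ hφ t) :=
  (ContinuousMap.continuous_postcomp ⟨φ, hφ.continuous⟩).comp (ContinuousMap.continuous_precomp _)

variable [Fintype ι]

/-- The Laurent monomials on `(ℤ_pˣ)^ι`, as continuous functions with values in `E`. -/
noncomputable def laurentMonomial (φ : ℚ_[p] →+* E) (hφ : Isometry φ) (lam : ι → ℤ) :
    C(ι → ℤ_[p]ˣ, E) where
  toFun z := φ (∏ t, (((z t ^ lam t : ℤ_[p]ˣ) : ℤ_[p]) : ℚ_[p]))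
  continuous_toFun := hφ.continuous.comp <| continuous_finsetProd _ fun t _ =>
    (PadicInt.inclusion p).continuous.comp
      (Units.continuous_val.comp ((continuous_apply t).zpow _))

theorem laurentMonomial_zero (φ : ℚ_[p] →+* E) (hφ : Isometry φ) :
    laurentMonomial φ hφ (0 : ι → ℤ) = 1 := by
  ext z
  simp [laurentMonomial]

theorem laurentMonomial_add (φ : ℚ_[p] →+* E) (hφ : Isometry φ) (lam mu : ι → ℤ) :
    laurentMonomial φ hφ (lam + mu) = laurentMonomial φ hφ lam * laurentMonomial φ hφ mu := by
  ext z
  simp [laurentMonomial, zpow_add, Finset.prod_mul_distrib]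

/-- Changing the exponents by multiples of `φ(p ^ N)` changes a Laurent monomial by at most
`p ^ (-N)`. -/
theorem norm_laurentMonomial_sub_le (φ : ℚ_[p] →+* E) (hφ : Isometry φ) (mu c : ι → ℤ) (N : ℕ)
    (z : ι → ℤ_[p]ˣ) :
    ‖laurentMonomial φ hφ mu z
      - laurentMonomial φ hφ (fun t => mu t + (p ^ N).totient * c t) z‖ ≤ (p : ℝ) ^ (-N : ℤ) := by
  have hunit (lam : ι → ℤ) : laurentMonomial φ hφ lam z
      = φ ((((∏ t, z t ^ lam t : ℤ_[p]ˣ) : ℤ_[p]) : ℚ_[p])) := by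
    simp only [laurentMonomial, ContinuousMap.coe_mk, Units.coe_prod]
    congr 1
    exact (map_prod PadicInt.Coe.ringHom _ _).symm
  rw [hunit, hunit, ← map_sub, (AddMonoidHomClass.isometry_iff_norm φ).1 hφ, ← PadicInt.coe_sub,
    PadicInt.padic_norm_e_of_padicInt, ← PadicInt.toZModPow_eq_toZModPow_iff]
  let r := Units.map ((PadicInt.toZModPow N : ℤ_[p] →+* ZMod (p ^ N)) : ℤ_[p] →* ZMod (p ^ N))
  have key (u : ℤ_[p]ˣ) (a b : ℤ) :
      r (u ^ (a + (p ^ N).totient * b)) = r (u ^ a) := by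
    rw [map_zpow, map_zpow, zpow_add, zpow_mul, zpow_natCast, ZMod.pow_totient, one_zpow, mul_one]
  have : r (∏ t, z t ^ mu t)
      = r (∏ t, z t ^ (mu t + (p ^ N).totient * c t)) := by
    simp only [map_prod, key]
  exact congrArg Units.val this

theorem exists_strictAnti_add_mul {n : ℕ} (mu : Fin n → ℤ) :
    ∃ c : Fin n → ℤ, ∀ m : ℤ, 0 < m → StrictAnti fun t => mu t + m * c t := by
  refine ⟨fun t => -((1 + 2 * ∑ i, |mu i|) * (t : ℤ)), fun m hm i j hij => ?_⟩
  have hb (t : Fin n) : |mu t| ≤ ∑ i, |mu i| :=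
    Finset.single_le_sum (f := fun i => |mu i|) (fun i _ => abs_nonneg _) (Finset.mem_univ t)
  have hij' : (1 : ℤ) ≤ (j : ℤ) - i := by
    have : (i : ℕ) < j := hij
    omega
  have hi := abs_le.1 (hb i)
  have hj := abs_le.1 (hb j)
  have hC : 0 ≤ ∑ i, |mu i| := (abs_nonneg _).trans (hb i)
  have h1 : 1 ≤ m * ((j : ℤ) - i) := by nlinarith
  have h2 := mul_le_mul_of_nonneg_left h1 (by linarith : 0 ≤ 1 + 2 * ∑ i, |mu i|)
  simp only
  nlinarith

theorem laurentMonomial_mem_closure_span {n : ℕ} (φ : ℚ_[p] →+* E) (hφ : Isometry φ)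
    (mu : Fin n → ℤ) :
    laurentMonomial φ hφ mu ∈
      (Submodule.span E (laurentMonomial φ hφ '' {lam | StrictAnti lam})).topologicalClosure := by
  obtain ⟨c, hc⟩ := exists_strictAnti_add_mul mu
  refine Metric.mem_closure_iff.2 fun ε hε => ?_
  have hp : (1 : ℝ) < p := by exact_mod_cast (Fact.out : p.Prime).one_lt
  obtain ⟨N, hN⟩ := exists_pow_lt_of_lt_one hε (inv_lt_one_of_one_lt₀ hp)
  refine ⟨_, Submodule.subset_span ⟨fun t => mu t + (p ^ N).totient * c t, hc _ ?_, rfl⟩, ?_⟩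
  · exact_mod_cast Nat.totient_pos.2 (pow_pos (Fact.out : p.Prime).pos N)
  · refine (ContinuousMap.dist_lt_iff hε).2 fun z => ?_
    rw [dist_eq_norm]
    refine (norm_laurentMonomial_sub_le φ hφ mu c N z).trans_lt ?_
    rwa [zpow_neg, zpow_natCast, ← inv_pow]

/-- The submonoid of `C((ℤ_pˣ)^ι, E)` formed by the Laurent monomials. -/
def laurentMonomials (ι : Type*) [Fintype ι] (φ : ℚ_[p] →+* E) (hφ : Isometry φ) :
    Submonoid C(ι → ℤ_[p]ˣ, E) where
  carrier := Set.range (laurentMonomial φ hφ)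
  one_mem' := ⟨0, laurentMonomial_zero φ hφ⟩
  mul_mem' := by
    rintro _ _ ⟨lam, rfl⟩ ⟨mu, rfl⟩
    exact ⟨lam + mu, laurentMonomial_add φ hφ lam mu⟩

/-- The closed subalgebra of `C((ℤ_pˣ)^ι, E)` generated by the Laurent monomials. -/
noncomputable def laurentClosure (ι : Type*) [Fintype ι] (φ : ℚ_[p] →+* E) (hφ : Isometry φ) :
    Subalgebra E C(ι → ℤ_[p]ˣ, E) :=
  (Algebra.adjoin E (laurentMonomials ι φ hφ : Set C(ι → ℤ_[p]ˣ, E))).topologicalClosure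

theorem coordinatePullback_mem_laurentClosure (φ : ℚ_[p] →+* E) (hφ : Isometry φ) (t : ι)
    (g : C(ℤ_[p], ℚ_[p])) : coordinatePullback φ hφ t g ∈ laurentClosure ι φ hφ := by
  classical
  refine PadicInt.mem_of_isClosed_of_const_mem_of_inclusion_mem
    ((laurentClosure ι φ hφ).toSubring.comap (coordinatePullback φ hφ t)) ?_ (fun c => ?_) ?_ g
  · exact (Subalgebra.isClosed_topologicalClosure _).preimage
      (continuous_coordinatePullback φ hφ t)
  · exact (laurentClosure ι φ hφ).algebraMap_mem (φ c)
  · refine Subalgebra.le_topologicalClosure _ (Algebra.subset_adjoin ⟨Pi.single t 1, ?_⟩)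
    ext z
    rw [coordinatePullback_apply]
    change φ (∏ s, _) = φ _
    rw [Finset.prod_eq_single t]
    · simp
    · intro s _ hs
      simp [hs]
    · simp

/-- Continuous functions on `(ℤ_pˣ)^ι` are uniformly close to functions of the residues. -/
theorem exists_forall_toZModPow_eq_norm_sub_lt (f : C(ι → ℤ_[p]ˣ, E)) {ε : ℝ} (hε : 0 < ε) :
    ∃ k : ℕ, ∀ z w : ι → ℤ_[p]ˣ,
      (∀ t, PadicInt.toZModPow k (z t : ℤ_[p]) = PadicInt.toZModPow k (w t : ℤ_[p])) →
        ‖f z - f w‖ < ε := by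
  have hj : IsEmbedding (Pi.map fun (_ : ι) (u : ℤ_[p]ˣ) => (u : ℤ_[p])) :=
    IsEmbedding.piMap fun _ => Units.isOpenEmbedding_val.isEmbedding
  let _ : MetricSpace (ι → ℤ_[p]ˣ) := hj.comapMetricSpace
  obtain ⟨δ, hδ, hf⟩ := Metric.uniformContinuous_iff.1
    (CompactSpace.uniformContinuous_of_continuous f.continuous) ε hε
  have hp : (1 : ℝ) < p := by exact_mod_cast (Fact.out : p.Prime).one_lt
  obtain ⟨k, hk⟩ := exists_pow_lt_of_lt_one hδ (inv_lt_one_of_one_lt₀ hp)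
  refine ⟨k, fun z w hzw => ?_⟩
  rw [← dist_eq_norm]
  refine hf ?_
  change dist (fun t => (z t : ℤ_[p])) (fun t => (w t : ℤ_[p])) < δ
  refine (dist_pi_lt_iff hδ).2 fun t => ?_
  have := (PadicInt.toZModPow_eq_toZModPow_iff k _ _).1 (hzw t)
  rw [zpow_neg, zpow_natCast, ← inv_pow, ← dist_eq_norm] at this
  exact this.trans_lt hk

theorem mem_laurentClosure (φ : ℚ_[p] →+* E) (hφ : Isometry φ) (f : C(ι → ℤ_[p]ˣ, E)) :
    f ∈ laurentClosure ι φ hφ := by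
  classical
  have hcl : IsClosed (laurentClosure ι φ hφ : Set C(ι → ℤ_[p]ˣ, E)) :=
    Subalgebra.isClosed_topologicalClosure _
  rw [← SetLike.mem_coe, ← hcl.closure_eq]
  refine Metric.mem_closure_iff.2 fun ε hε => ?_
  obtain ⟨k, hk⟩ := exists_forall_toZModPow_eq_norm_sub_lt f hε
  let res : (ι → ℤ_[p]ˣ) → ι → ZMod (p ^ k) := fun z t => PadicInt.toZModPow k (z t : ℤ_[p])
  have : NeZero (p ^ k) := ⟨pow_ne_zero k (Fact.out : p.Prime).ne_zero⟩
  let g : C(ι → ℤ_[p]ˣ, E) := ∑ c : ι → ZMod (p ^ k), f (Function.invFun res c) •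
    ∏ t, coordinatePullback φ hφ t (PadicInt.residueIndicator k (c t))
  have hg (z : ι → ℤ_[p]ˣ) : g z = f (Function.invFun res (res z)) := by
    simp only [g, ContinuousMap.sum_apply, ContinuousMap.smul_apply, ContinuousMap.prod_apply,
      coordinatePullback_apply]
    rw [Finset.sum_eq_single (res z)]
    · simp [PadicInt.residueIndicator, res]
    · intro c _ hc
      obtain ⟨t, ht⟩ := Function.ne_iff.1 hc
      rw [Finset.prod_eq_zero (Finset.mem_univ t), smul_zero]
      have : PadicInt.toZModPow k (z t : ℤ_[p]) ≠ c t := ht.symm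
      simp [PadicInt.residueIndicator, this]
    · simp
  refine ⟨g, ?_, (ContinuousMap.dist_lt_iff hε).2 fun z => ?_⟩
  · exact sum_mem fun c _ => Subalgebra.smul_mem _
      (prod_mem fun t _ => coordinatePullback_mem_laurentClosure φ hφ t _) _
  · rw [hg, dist_eq_norm]
    exact hk _ _ fun t => (congrFun (Function.invFun_eq (f := res) ⟨z, rfl⟩) t).symm

theorem mem_closure_span_strictAnti {n : ℕ} (φ : ℚ_[p] →+* E) (hφ : Isometry φ)
    (f : C(Fin n → ℤ_[p]ˣ, E)) :
    f ∈ (Submodule.span E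
      (laurentMonomial φ hφ '' {lam | StrictAnti lam})).topologicalClosure := by
  have hle : Subalgebra.toSubmodule
      (Algebra.adjoin E (laurentMonomials (Fin n) φ hφ : Set C(Fin n → ℤ_[p]ˣ, E))) ≤
      (Submodule.span E (laurentMonomial φ hφ '' {lam | StrictAnti lam})).topologicalClosure := by
    rw [Algebra.adjoin_eq_span, Submonoid.closure_eq, Submodule.span_le]
    rintro _ ⟨mu, rfl⟩
    exact laurentMonomial_mem_closure_span φ hφ mu
  exact closure_minimal hle (Submodule.isClosed_topologicalClosure _) (mem_laurentClosure φ hφ f)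

end Density



/-- The `E`-linear span of the monomial functions `(z₁, …, z_n) ↦ z₁^{λ₁} ⋯ z_n^{λ_n}` on
`(ℤ_pˣ)^n`, for strictly decreasing integer tuples `λ₁ > λ₂ > ⋯ > λ_n`, is dense (for the
supremum norm) in the continuous functions `(ℤ_pˣ)^n → E`, where `E` is a complete
nonarchimedean normed field receiving an isometric embedding of `ℚ_p`. -/
theorem span_strictly_dominant_monomials_dense
    (p : ℕ) [Fact p.Prime] {n : ℕ} (hn : 1 ≤ n)
    {E : Type*} [NormedField E] [CompleteSpace E] [IsUltrametricDist E]
    (φ : ℚ_[p] →+* E) (hφ : Isometry φ)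
    (f : (Fin n → ℤ_[p]ˣ) → E) (hf : Continuous f) {ε : ℝ} (hε : 0 < ε) :
    ∃ g ∈ Submodule.span E {h : (Fin n → ℤ_[p]ˣ) → E |
        ∃ lam : Fin n → ℤ, StrictAnti lam ∧
          h = fun z => φ (∏ t : Fin n, (((z t ^ lam t : ℤ_[p]ˣ) : ℤ_[p]) : ℚ_[p]))},
      ∀ z, ‖f z - g z‖ < ε := by
  obtain ⟨g, hg, hfg⟩ :=
    Metric.mem_closure_iff.1 (mem_closure_span_strictAnti φ hφ ⟨f, hf⟩) ε hε
  refine ⟨g, ?_, fun z => ?_⟩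
  · have := Submodule.mem_map_of_mem (f := ContinuousMap.coeFnLinearMap E) hg
    rw [Submodule.map_span] at this
    refine Submodule.span_mono ?_ this
    rintro _ ⟨_, ⟨lam, hlam, rfl⟩, rfl⟩
    exact ⟨lam, hlam, rfl⟩
  · rw [← dist_eq_norm]
    exact (ContinuousMap.dist_lt_iff hε).1 hfg z
end
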